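/- arXiv:2603.08539 — 2 statements merged into one kernel-verified Lean document; each statement's English description precedes it below -/
import Mathlib

section
/- Let n, d be positive integers, G a connected subgraph of K_{n,d}, and M a G-tropical oriented matroid. Then the collection 𝒢 = {E(A) : A ∈ M and E(A) is connected} encodes a polyhedral subdivision of the root polytope Q_G; that is, the union of Q_{E(A)} over all connected types A ∈ M equals Q_G, and for any two connected types A, B ∈ M the set Q_{E(A)} ∩ Q_{E(B)} is extreme (IsExtreme ℝ) in Q_{E(A)} and in Q_{E(B)}. -/
open Finset Pointwise

/-- The bipartite graph on vertex set `α ⊕ β` whose edges are the pairs in `S`. -/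
def bipGraph {α β : Type*} (S : Set (α × β)) : SimpleGraph (α ⊕ β) where
  Adj u v := ∃ a b, (a, b) ∈ S ∧
    ((u = Sum.inl a ∧ v = Sum.inr b) ∨ (u = Sum.inr b ∧ v = Sum.inl a))
  symm := by
    constructor
    rintro u v ⟨a, b, h, (⟨rfl, rfl⟩ | ⟨rfl, rfl⟩)⟩
    · exact ⟨a, b, h, Or.inr ⟨rfl, rfl⟩⟩
    · exact ⟨a, b, h, Or.inl ⟨rfl, rfl⟩⟩
  loopless := by
    constructor
    rintro u ⟨a, b, h, (⟨rfl, hv⟩ | ⟨rfl, hv⟩)⟩ <;> simp at hv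

/-- The edge set of an `(n,d)`-type. -/
def typeEdges {n d : ℕ} (A : Fin n → Finset (Fin d)) : Set (Fin n × Fin d) :=
  {p | p.2 ∈ A p.1}

/-- A subgraph of `K_{n,d}` is connected. -/
def IsConn {n d : ℕ} (S : Set (Fin n × Fin d)) : Prop :=
  (bipGraph S).Connected

/-- `A` is an `(n,d)`-type: every coordinate is nonempty. -/
def IsType {n d : ℕ} (A : Fin n → Finset (Fin d)) : Prop := ∀ i, (A i).Nonempty

/-- Compatibility of two subgraphs of `K_{n,d}`. -/
def Compatible {n d : ℕ} (A B : Set (Fin n × Fin d)) : Prop :=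
  ∀ (k : ℕ) (i : Fin (k + 2) → Fin n) (j : Fin (k + 2) → Fin d),
    Function.Injective i → Function.Injective j →
    (∀ t, (i t, j t) ∈ A) → (∀ t, (i (t + 1), j t) ∈ B) →
    ∀ t, (i t, j t) ∈ A ∧ (i t, j t) ∈ B ∧ (i (t + 1), j t) ∈ A ∧ (i (t + 1), j t) ∈ B

/-- An ordered partition of `Fin d` into nonempty parts. -/
structure OrderedPartition (d : ℕ) where
  r : ℕ
  parts : Fin r → Finset (Fin d)
  nonempty : ∀ k, (parts k).Nonempty
  disjoint : ∀ k l, k ≠ l → Disjoint (parts k) (parts l)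
  covers : ∀ j, ∃ k, j ∈ parts k

/-- `B` is the refinement of `A` with respect to the ordered partition `P`. -/
def IsRefinement {n d : ℕ} (A : Fin n → Finset (Fin d)) (P : OrderedPartition d)
    (B : Fin n → Finset (Fin d)) : Prop :=
  ∀ i, ∃ k, B i = A i ∩ P.parts k ∧ (A i ∩ P.parts k).Nonempty ∧
    ∀ l, l < k → A i ∩ P.parts l = ∅

/-- `B` is the total refinement of `A` with respect to the linear order on `Fin d` whose
rank function is `σ`. -/
def IsTotalRefinement {n d : ℕ} (A : Fin n → Finset (Fin d)) (σ : Equiv.Perm (Fin d))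
    (B : Fin n → Finset (Fin d)) : Prop :=
  ∀ i, ∃ j ∈ A i, B i = {j} ∧ ∀ j' ∈ A i, σ j ≤ σ j'

/-- The type associated to a subgraph `G` of `K_{n,d}`. -/
def graphType {n d : ℕ} (G : Finset (Fin n × Fin d)) : Fin n → Finset (Fin d) :=
  fun i => Finset.univ.filter fun j => (i, j) ∈ G

/-- `M` is a `G`-tropical oriented matroid. -/
structure IsGTOM {n d : ℕ} (G : Finset (Fin n × Fin d))
    (M : Set (Fin n → Finset (Fin d))) : Prop where
  isType : ∀ A ∈ M, IsType A
  subgraph : ∀ A ∈ M, typeEdges A ⊆ (↑G : Set (Fin n × Fin d))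
  boundary : ∀ (σ : Equiv.Perm (Fin d)) (B : Fin n → Finset (Fin d)),
    IsTotalRefinement (graphType G) σ B → B ∈ M
  surrounding : ∀ A ∈ M, ∀ (P : OrderedPartition d) (B : Fin n → Finset (Fin d)),
    IsRefinement A P B → B ∈ M
  comparability : ∀ A ∈ M, ∀ B ∈ M, Compatible (typeEdges A) (typeEdges B)
  elimination : ∀ A ∈ M, ∀ B ∈ M, ∀ i : Fin n, ∃ C ∈ M,
    C i = A i ∪ B i ∧ ∀ i', C i' = A i' ∨ C i' = B i' ∨ C i' = A i' ∪ B i'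

/-- The vertex of `Δ^{n-1} × Δ^{d-1}` associated to a pair `(i, j)`. -/
def rootVert {n d : ℕ} (p : Fin n × Fin d) : (Fin n → ℝ) × (Fin d → ℝ) :=
  (Pi.single p.1 1, Pi.single p.2 1)

/-- The root polytope `Q_S` of a subgraph `S ⊆ K_{n,d}`. -/
def rootPoly {n d : ℕ} (S : Set (Fin n × Fin d)) : Set ((Fin n → ℝ) × (Fin d → ℝ)) :=
  convexHull ℝ (rootVert '' S)

/-- A collection `𝒢` of subgraphs encodes a polyhedral subdivision of `Q_G`. -/
def EncodesSubdivision {n d : ℕ} (G : Set (Fin n × Fin d))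
    (𝒢 : Set (Set (Fin n × Fin d))) : Prop :=
  (⋃ S ∈ 𝒢, rootPoly S) = rootPoly G ∧
  ∀ S ∈ 𝒢, ∀ T ∈ 𝒢, IsExtreme ℝ (rootPoly S) (rootPoly S ∩ rootPoly T) ∧
    IsExtreme ℝ (rootPoly T) (rootPoly S ∩ rootPoly T)

/-- Connectivity of the edge set `S` restricted to the vertex sets `I ⊕ J`. -/
def connOn {n d : ℕ} (I : Set (Fin n)) (J : Set (Fin d)) (S : Set (Fin n × Fin d)) : Prop :=
  (bipGraph {p : ↥I × ↥J | ((p.1 : Fin n), (p.2 : Fin d)) ∈ S}).Connected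

/-- The generalized permutohedron (Minkowski sum of faces of the simplex). -/
def gPerm {n d : ℕ} (J : Fin n → Finset (Fin d)) : Set (Fin d → ℝ) :=
  ∑ i : Fin n, convexHull ℝ ((fun j => Pi.single j (1 : ℝ)) '' ↑(J i))


namespace GTOM

/-- alternating walk from column `j` to row `i`. -/
def AltWalk {n d : ℕ} (A B : Set (Fin n × Fin d)) (i : Fin n) (j : Fin d) (k : ℕ) : Prop :=
  ∃ (ii : ℕ → Fin n) (jj : ℕ → Fin d), jj 0 = j ∧ ii k = i ∧
    (∀ t, t ≤ k → (ii t, jj t) ∈ B) ∧ (∀ t, t < k → (ii t, jj (t + 1)) ∈ A)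

lemma altWalk_key {n d : ℕ} {A B : Set (Fin n × Fin d)} (h : Compatible A B)
    {i : Fin n} {j : Fin d} (hij : (i, j) ∈ A) (hw : ∃ k, AltWalk A B i j k) : (i, j) ∈ B := by
  classical
  obtain ⟨ii, jj, h0, hk, hB, hA⟩ := Nat.find_spec hw
  have hmin : ∀ m, m < Nat.find hw → ¬ AltWalk A B i j m := fun m hm => Nat.find_min hw hm
  generalize Nat.find hw = k at *
  have injj : ∀ a b, a < b → b ≤ k → jj a ≠ jj b := by
    intro a b hab hbk he
    apply hmin (k - (b - a)) (by omega)
    refine ⟨fun t => if t < a then ii t else ii (t + (b - a)),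
      fun t => if t < a then jj t else jj (t + (b - a)), ?_, ?_, ?_, ?_⟩
    · by_cases ha : 0 < a
      · simp [ha, h0]
      · have : a = 0 := by omega
        subst this
        simp [← he, h0]
    · have h1 : ¬ (k - (b - a) < a) := by omega
      have h2 : k - (b - a) + (b - a) = k := by omega
      simp only [h1, if_false, h2, hk]
    · intro t ht
      by_cases h1 : t < a
      · simp only [h1, if_true]; exact hB t (by omega)
      · simp only [h1, if_false]; exact hB _ (by omega)
    · intro t ht
      by_cases h1 : t < a
      · by_cases h2 : t + 1 < a
        · simp only [h1, h2, if_true]; exact hA t (by omega)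
        · have h3 : t + 1 = a := by omega
          have h4 : t + 1 + (b - a) = b := by omega
          simp only [h1, h2, if_true, if_false, h4, ← he]
          rw [← h3]; exact hA t (by omega)
      · have h2 : ¬ (t + 1 < a) := by omega
        simp only [h1, h2, if_false]
        have := hA (t + (b - a)) (by omega)
        rwa [show t + 1 + (b - a) = t + (b - a) + 1 by omega]
  have inji : ∀ a b, a < b → b ≤ k → ii a ≠ ii b := by
    intro a b hab hbk he
    apply hmin (k - (b - a)) (by omega)
    refine ⟨fun t => if t < a then ii t else ii (t + (b - a)),
      fun t => if t ≤ a then jj t else jj (t + (b - a)), ?_, ?_, ?_, ?_⟩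
    · simp [h0]
    · have h1 : ¬ (k - (b - a) < a) := by omega
      have h2 : k - (b - a) + (b - a) = k := by omega
      simp only [h1, if_false, h2, hk]
    · intro t ht
      rcases lt_trichotomy t a with h1 | h1 | h1
      · simp only [h1, h1.le, if_true]; exact hB t (by omega)
      · subst h1
        have h4 : t + (b - t) = b := by omega
        simp only [lt_irrefl, le_refl, if_true, if_false, h4, ← he]
        exact hB t (by omega)
      · have h2 : ¬ (t < a) := by omega
        have h3 : ¬ (t ≤ a) := by omega
        simp only [h2, h3, if_false]; exact hB _ (by omega)
    · intro t ht
      by_cases h1 : t < a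
      · have h2 : t + 1 ≤ a := by omega
        simp only [h1, h2, if_true]; exact hA t (by omega)
      · have h2 : ¬ (t + 1 ≤ a) := by omega
        simp only [h1, h2, if_false]
        have := hA (t + (b - a)) (by omega)
        rwa [show t + 1 + (b - a) = t + (b - a) + 1 by omega]
  rcases Nat.eq_zero_or_pos k with hk0 | hk0
  · subst hk0
    have := hB 0 le_rfl
    rwa [hk, h0] at this
  · obtain ⟨m, rfl⟩ : ∃ m, k = m + 1 := ⟨k - 1, by omega⟩
    have e0 : (((0 : Fin (m + 2)) - 1 : Fin (m + 2)) : ℕ) = m + 1 := by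
      simp
    have es : ∀ t : Fin (m + 2), t ≠ 0 → ((t - 1 : Fin (m + 2)) : ℕ) = (t : ℕ) - 1 := by
      intro t ht
      exact Fin.val_sub_one_of_ne_zero ht
    have key := h m (fun t => ii ((t - 1 : Fin (m + 2)) : ℕ)) (fun t => jj (t : ℕ)) ?_ ?_ ?_ ?_ 0
    · have := key.2.1
      simp only [e0, hk] at this
      simpa [h0] using this
    · intro s t hst
      have hv : ((s - 1 : Fin (m + 2)) : ℕ) = ((t - 1 : Fin (m + 2)) : ℕ) := by
        by_contra hne
        rcases lt_or_gt_of_ne hne with hlt | hlt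
        · exact inji _ _ hlt (by have := (t - 1).isLt; omega) hst
        · exact inji _ _ hlt (by have := (s - 1).isLt; omega) hst.symm
      have := Fin.ext hv
      exact sub_left_injective this
    · intro s t hst
      by_contra hne
      have hne' : (s : ℕ) ≠ t := fun e => hne (Fin.ext e)
      rcases lt_or_gt_of_ne hne' with hlt | hlt
      · exact injj _ _ hlt (by have := t.isLt; omega) hst
      · exact injj _ _ hlt (by have := s.isLt; omega) hst.symm
    · intro t
      by_cases ht : t = 0
      · subst ht
        simp only [e0, hk]
        simpa [h0] using hij
      · have hv : (t : ℕ) ≠ 0 := fun e => ht (Fin.ext e)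
        simp only [es t ht]
        have := hA ((t : ℕ) - 1) (by have := t.isLt; omega)
        rwa [show (t : ℕ) - 1 + 1 = t by omega] at this
    · intro t
      simp only [add_sub_cancel_right]
      exact hB t (by have := t.isLt; omega)

/-- directed residual relation. -/
def Dr {n d : ℕ} (A B : Set (Fin n × Fin d)) : Fin n ⊕ Fin d → Fin n ⊕ Fin d → Prop
  | Sum.inl i, Sum.inr j => (i, j) ∈ A
  | Sum.inr j, Sum.inl i => (i, j) ∈ B
  | _, _ => False

lemma reach_altWalk {n d : ℕ} {A B : Set (Fin n × Fin d)} {i : Fin n} {w : Fin n ⊕ Fin d}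
    (h : Relation.ReflTransGen (Dr A B) w (Sum.inl i)) :
    (∀ j, w = Sum.inr j → ∃ k, AltWalk A B i j k) ∧
    (∀ i0, w = Sum.inl i0 → i0 = i ∨ ∃ j, (i0, j) ∈ A ∧ ∃ k, AltWalk A B i j k) := by
  induction h using Relation.ReflTransGen.head_induction_on with
  | refl =>
    refine ⟨fun j hj => by simp at hj, fun i0 h0 => Or.inl ?_⟩
    simpa using h0.symm
  | head hac hcb ih =>
    rename_i a c
    constructor
    · rintro j rfl
      rcases c with i0 | j0
      · have hB : (i0, j) ∈ B := hac
        rcases ih.2 i0 rfl with rfl | ⟨j1, hj1, k, ii, jj, h0, hk, hB', hA'⟩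
        · exact ⟨0, fun _ => i0, fun _ => j, rfl, rfl, fun _ _ => hB, fun t ht => by omega⟩
        · refine ⟨k + 1, fun t => if t = 0 then i0 else ii (t - 1),
            fun t => if t = 0 then j else jj (t - 1), by simp, by simp [hk], ?_, ?_⟩
          · intro t ht
            by_cases h : t = 0
            · simp [h, hB]
            · simp only [h, if_false]; exact hB' _ (by omega)
          · intro t ht
            by_cases h : t = 0
            · simp [h, h0, hj1]
            · have := hA' (t - 1) (by omega)
              rw [show t - 1 + 1 = t by omega] at this
              simpa [h] using this
      · exact absurd hac (by simp [Dr])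
    · rintro i0 rfl
      rcases c with i1 | j0
      · exact absurd hac (by simp [Dr])
      · exact Or.inr ⟨j0, hac, ih.1 j0 rfl⟩

lemma Dr_swap {n d : ℕ} {A B : Set (Fin n × Fin d)} {w z : Fin n ⊕ Fin d}
    (h : Dr A B w z) : Dr B A z w := by
  rcases w with i | j <;> rcases z with i' | j' <;> simp_all [Dr]

/-- compatible subgraphs admit separating potentials. -/
lemma exists_potential {n d : ℕ} {A B : Set (Fin n × Fin d)} (h : Compatible A B)
    (h' : Compatible B A) : ∃ (u : Fin n → ℝ) (v : Fin d → ℝ),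
      (∀ i j, (i, j) ∈ A → v j ≤ u i) ∧ (∀ i j, (i, j) ∈ B → u i ≤ v j) ∧
      (∀ i j, (i, j) ∈ A → u i = v j → (i, j) ∈ B) ∧
      (∀ i j, (i, j) ∈ B → u i = v j → (i, j) ∈ A) := by
  classical
  set R : Fin n ⊕ Fin d → Finset (Fin n ⊕ Fin d) := fun w =>
    Finset.univ.filter fun z => Relation.ReflTransGen (Dr A B) w z with hR
  have hsub : ∀ w z, Dr A B w z → R z ⊆ R w := by
    intro w z hwz y hy
    simp only [hR, Finset.mem_filter, Finset.mem_univ, true_and] at hy ⊢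
    exact Relation.ReflTransGen.head hwz hy
  have heq : ∀ w z, Dr A B w z → (R w).card = (R z).card →
      Relation.ReflTransGen (Dr A B) z w := by
    intro w z hwz hc
    have := Finset.eq_of_subset_of_card_le (hsub w z hwz) hc.le
    have hw : w ∈ R w := by simp [hR, Relation.ReflTransGen.refl]
    rw [← this] at hw
    simpa [hR] using hw
  refine ⟨fun i => ((R (Sum.inl i)).card : ℝ), fun j => ((R (Sum.inr j)).card : ℝ), ?_, ?_, ?_, ?_⟩
  · intro i j hij
    beta_reduce
    exact_mod_cast Finset.card_le_card (hsub (Sum.inl i) (Sum.inr j) hij)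
  · intro i j hij
    beta_reduce
    exact_mod_cast Finset.card_le_card (hsub (Sum.inr j) (Sum.inl i) hij)
  · intro i j hij he
    beta_reduce at he
    have := heq (Sum.inl i) (Sum.inr j) hij (by exact_mod_cast he)
    exact altWalk_key h hij ((reach_altWalk this).1 j rfl)
  · intro i j hij he
    beta_reduce at he
    have := heq (Sum.inr j) (Sum.inl i) hij (by exact_mod_cast he.symm)
    have h2 : Relation.ReflTransGen (Dr B A) (Sum.inr j) (Sum.inl i) := by
      have := Relation.reflTransGen_swap.2 this
      exact Relation.ReflTransGen.mono (fun a b hab => Dr_swap hab) _ _ this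
    exact altWalk_key h' hij ((reach_altWalk h2).1 j rfl)

/-- Row-restricted version of the axioms used in the covering argument. -/
structure T {n d : ℕ} (S : Finset (Fin n)) (G : Fin n → Finset (Fin d))
    (M : Set (Fin n → Finset (Fin d))) : Prop where
  ne : ∀ A ∈ M, ∀ i ∈ S, (A i).Nonempty
  sub : ∀ A ∈ M, ∀ i ∈ S, A i ⊆ G i
  bdry : ∀ ρ : Fin d → ℕ, ∃ B ∈ M, ∀ i ∈ S, ∀ j ∈ B i, ∀ j' ∈ G i, ρ j ≤ ρ j'
  pot : ∀ A ∈ M, ∀ B ∈ M, ∃ (u : Fin n → ℝ) (v : Fin d → ℝ),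
      (∀ i j, j ∈ A i → v j ≤ u i) ∧ (∀ i j, j ∈ B i → u i ≤ v j) ∧
      (∀ i j, j ∈ A i → u i = v j → j ∈ B i)
  elim : ∀ A ∈ M, ∀ B ∈ M, ∀ i ∈ S, ∃ C ∈ M,
    C i = A i ∪ B i ∧ ∀ i' ∈ S, C i' = A i' ∨ C i' = B i' ∨ C i' = A i' ∪ B i'

lemma T.mono {n d : ℕ} {S S' : Finset (Fin n)} {G : Fin n → Finset (Fin d)}
    {M : Set (Fin n → Finset (Fin d))} (h : T S G M) (hS : S' ⊆ S) : T S' G M where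
  ne A hA i hi := h.ne A hA i (hS hi)
  sub A hA i hi := h.sub A hA i (hS hi)
  bdry ρ := by
    obtain ⟨B, hB, hb⟩ := h.bdry ρ
    exact ⟨B, hB, fun i hi => hb i (hS hi)⟩
  pot := h.pot
  elim A hA B hB i hi := by
    obtain ⟨C, hC, h1, h2⟩ := h.elim A hA B hB i (hS hi)
    exact ⟨C, hC, h1, fun i' hi' => h2 i' (hS hi')⟩

/-- refinement of `G` by the partition `(K, Kᶜ)`. -/
def ref {n d : ℕ} (G : Fin n → Finset (Fin d)) (K : Finset (Fin d)) : Fin n → Finset (Fin d) :=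
  fun i => if (G i ∩ K).Nonempty then G i ∩ K else G i

lemma ref_sub {n d : ℕ} (G : Fin n → Finset (Fin d)) (K : Finset (Fin d)) (i : Fin n) :
    ref G K i ⊆ G i := by
  unfold ref
  split_ifs
  · exact Finset.inter_subset_left
  · exact subset_rfl

lemma T.ref {n d : ℕ} {S : Finset (Fin n)} {G : Fin n → Finset (Fin d)}
    {M : Set (Fin n → Finset (Fin d))} (h : T S G M) (K : Finset (Fin d)) :
    T S (ref G K) {B ∈ M | ∀ i ∈ S, B i ⊆ GTOM.ref G K i} where
  ne A hA i hi := h.ne A hA.1 i hi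
  sub A hA i hi := hA.2 i hi
  bdry ρ := by
    obtain ⟨B, hB, hb⟩ := h.bdry
      (fun j => if j ∈ K then ρ j else ρ j + (∑ j', ρ j' + 1))
    have hle : ∀ j, ρ j ≤ ∑ j', ρ j' := fun j =>
      Finset.single_le_sum (f := ρ) (fun _ _ => Nat.zero_le _) (Finset.mem_univ j)
    have hsub : ∀ i ∈ S, B i ⊆ GTOM.ref G K i := by
      intro i hi j hj
      have hjG := h.sub B hB i hi hj
      unfold GTOM.ref
      split_ifs with hne
      · obtain ⟨j', hj'⟩ := hne
        rw [Finset.mem_inter] at hj' ⊢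
        refine ⟨hjG, ?_⟩
        by_contra hjK
        have := hb i hi j hj j' hj'.1
        simp only [hjK, hj'.2, if_true, if_false] at this
        have := hle j'
        omega
      · exact hjG
    refine ⟨B, ⟨hB, hsub⟩, fun i hi j hj j' hj' => ?_⟩
    have h1 := hb i hi j hj j' (ref_sub G K i hj')
    have h2 := hsub i hi hj
    unfold GTOM.ref at h2 hj'
    split_ifs at h2 hj' with hne
    · simp only [(Finset.mem_inter.1 h2).2, (Finset.mem_inter.1 hj').2, if_true] at h1
      exact h1
    · have a1 : j ∉ K := fun hk => hne ⟨j, Finset.mem_inter.2 ⟨h2, hk⟩⟩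
      have a2 : j' ∉ K := fun hk => hne ⟨j', Finset.mem_inter.2 ⟨hj', hk⟩⟩
      simp only [a1, a2, if_false] at h1
      omega
  pot A hA B hB := h.pot A hA.1 B hB.1
  elim A hA B hB i hi := by
    obtain ⟨C, hC, h1, h2⟩ := h.elim A hA.1 B hB.1 i hi
    refine ⟨C, ⟨hC, fun i' hi' => ?_⟩, h1, h2⟩
    rcases h2 i' hi' with e | e | e <;> rw [e]
    · exact hA.2 i' hi'
    · exact hB.2 i' hi'
    · exact Finset.union_subset (hA.2 i' hi') (hB.2 i' hi')

/-- weak covering property. -/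
def WC {n d : ℕ} (S : Finset (Fin n)) : Prop :=
  ∀ (G : Fin n → Finset (Fin d)) (M : Set (Fin n → Finset (Fin d))), T S G M →
    ∀ f : Fin n → Fin d → ℝ, (∀ i j, 0 ≤ f i j) → (∀ i ∈ S, ∀ j, f i j ≠ 0 → j ∈ G i) →
    ∃ A ∈ M, ∃ g : Fin n → Fin d → ℝ, (∀ i j, 0 ≤ g i j) ∧
      (∀ i ∈ S, ∀ j, g i j ≠ 0 → j ∈ A i) ∧
      (∀ i ∈ S, ∑ j, g i j = ∑ j, f i j) ∧ (∀ j, ∑ i ∈ S, g i j = ∑ i ∈ S, f i j)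

lemma pot_sum {n d : ℕ} (S : Finset (Fin n)) (g : Fin n → Fin d → ℝ) (u : Fin n → ℝ)
    (v : Fin d → ℝ) : ∑ i ∈ S, ∑ j, g i j * (u i - v j) =
      ∑ i ∈ S, u i * ∑ j, g i j - ∑ j, v j * ∑ i ∈ S, g i j := by
  have : ∑ j, v j * ∑ i ∈ S, g i j = ∑ i ∈ S, ∑ j, v j * g i j := by
    rw [Finset.sum_comm]
    simp only [Finset.mul_sum]
  rw [this, ← Finset.sum_sub_distrib]
  refine Finset.sum_congr rfl fun i _ => ?_
  rw [Finset.mul_sum, ← Finset.sum_sub_distrib]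
  exact Finset.sum_congr rfl fun j _ => by ring

/-- two types carrying flows with equal margins. -/
lemma supp_of_margins {n d : ℕ} {S : Finset (Fin n)} {A B : Fin n → Finset (Fin d)}
    (hp : ∃ (u : Fin n → ℝ) (v : Fin d → ℝ),
      (∀ i j, j ∈ A i → v j ≤ u i) ∧ (∀ i j, j ∈ B i → u i ≤ v j) ∧
      (∀ i j, j ∈ A i → u i = v j → j ∈ B i))
    {g g' : Fin n → Fin d → ℝ} (g0 : ∀ i j, 0 ≤ g i j) (g0' : ∀ i j, 0 ≤ g' i j)
    (hg : ∀ i ∈ S, ∀ j, g i j ≠ 0 → j ∈ A i) (hg' : ∀ i ∈ S, ∀ j, g' i j ≠ 0 → j ∈ B i)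
    (hr : ∀ i ∈ S, ∑ j, g' i j = ∑ j, g i j) (hc : ∀ j, ∑ i ∈ S, g' i j = ∑ i ∈ S, g i j) :
    ∀ i ∈ S, ∀ j, g i j ≠ 0 → j ∈ B i := by
  obtain ⟨u, v, hA, hB, hAB⟩ := hp
  have e : ∑ i ∈ S, ∑ j, g i j * (u i - v j) = ∑ i ∈ S, ∑ j, g' i j * (u i - v j) := by
    rw [pot_sum, pot_sum]
    congr 1
    · exact Finset.sum_congr rfl fun i hi => by rw [hr i hi]
    · exact Finset.sum_congr rfl fun j _ => by rw [hc j]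
  have t1 : ∀ i ∈ S, ∀ j, 0 ≤ g i j * (u i - v j) := by
    intro i hi j
    by_cases h : g i j = 0
    · simp [h]
    · exact mul_nonneg (g0 i j) (sub_nonneg.2 (hA i j (hg i hi j h)))
  have t2 : ∀ i ∈ S, ∀ j, g' i j * (u i - v j) ≤ 0 := by
    intro i hi j
    by_cases h : g' i j = 0
    · simp [h]
    · exact mul_nonpos_of_nonneg_of_nonpos (g0' i j) (sub_nonpos.2 (hB i j (hg' i hi j h)))
  have s1 : ∀ i ∈ S, 0 ≤ ∑ j, g i j * (u i - v j) := fun i hi =>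
    Finset.sum_nonneg fun j _ => t1 i hi j
  have z : ∑ i ∈ S, ∑ j, g i j * (u i - v j) = 0 := by
    apply le_antisymm
    · rw [e]
      exact Finset.sum_nonpos fun i hi => Finset.sum_nonpos fun j _ => t2 i hi j
    · exact Finset.sum_nonneg s1
  intro i hi j hij
  have z1 := (Finset.sum_eq_zero_iff_of_nonneg s1).1 z i hi
  have z2 := (Finset.sum_eq_zero_iff_of_nonneg (fun j _ => t1 i hi j)).1 z1 j (Finset.mem_univ j)
  have z3 : u i - v j = 0 := (mul_eq_zero.1 z2).resolve_left hij
  exact hAB i j (hg i hi j hij) (by linarith)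

/-- extension lemma. -/
lemma ext_step {n d : ℕ} {S : Finset (Fin n)} {G : Fin n → Finset (Fin d)}
    {M : Set (Fin n → Finset (Fin d))} (h : T S G M)
    (IH : ∀ S' : Finset (Fin n), S' ⊂ S → WC (d := d) S')
    {A : Fin n → Finset (Fin d)} (hA : A ∈ M) {g : Fin n → Fin d → ℝ}
    (g0 : ∀ i j, 0 ≤ g i j) (hg : ∀ i ∈ S, ∀ j, g i j ≠ 0 → j ∈ A i)
    (I : Finset (Fin n)) (J : Finset (Fin d))
    (hI' : ∀ i ∈ S, i ∉ I → ∀ j, g i j ≠ 0 → j ∉ J)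
    (hex : ∃ i ∈ S, i ∈ I ∧ ∃ j ∈ G i, j ∉ J) :
    ∃ C ∈ M, (∀ i ∈ S, ∀ j, g i j ≠ 0 → j ∈ C i) ∧
      ∃ i ∈ S, i ∈ I ∧ ∃ j ∈ C i, j ∉ J := by
  classical
  set I1 : Finset (Fin n) := S.filter fun i => i ∈ I ∧ ∃ j ∈ G i, j ∉ J with hI1
  have hT := (h.ref Jᶜ).mono (S' := S \ I1) Finset.sdiff_subset
  have hss : S \ I1 ⊂ S := by
    obtain ⟨i, hi, h1⟩ := hex
    refine Finset.ssubset_iff_subset_ne.2 ⟨Finset.sdiff_subset, fun e => ?_⟩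
    have : i ∈ S \ I1 := by rw [e]; exact hi
    rw [Finset.mem_sdiff] at this
    exact this.2 (by simp only [hI1, Finset.mem_filter]; exact ⟨hi, h1⟩)
  obtain ⟨B, hB, g', g0', hg', hr, hc⟩ := IH _ hss _ _ hT g g0 (by
    intro i hi j hij
    rw [Finset.mem_sdiff] at hi
    have hjA := hg i hi.1 j hij
    have hjG := h.sub A hA i hi.1 hjA
    unfold ref
    split_ifs with hne
    · rw [Finset.mem_inter, Finset.mem_compl]
      refine ⟨hjG, hI' i hi.1 (fun hiI => hi.2 ?_) j hij⟩
      obtain ⟨j', hj'⟩ := hne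
      rw [Finset.mem_inter, Finset.mem_compl] at hj'
      simp only [hI1, Finset.mem_filter]
      exact ⟨hi.1, hiI, j', hj'⟩
    · exact hjG)
  have hgB := supp_of_margins (h.pot A hA B hB.1) g0 g0'
    (fun i hi => hg i (Finset.mem_sdiff.1 hi).1) hg' hr hc
  have hBI1 : ∀ i ∈ I1, ∀ j ∈ B i, j ∉ J := by
    intro i hi j hj
    simp only [hI1, Finset.mem_filter] at hi
    have := hB.2 i hi.1 hj
    unfold ref at this
    obtain ⟨j', hj', hJ'⟩ := hi.2.2
    rw [if_pos ⟨j', by simp [hj', hJ']⟩] at this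
    simpa using (Finset.mem_inter.1 this).2
  have main : ∀ m : ℕ, ∀ C ∈ M, (I1.filter fun i => ¬ A i ⊆ C i).card = m →
      (∀ i ∈ S, i ∉ I1 → ∀ j, g i j ≠ 0 → j ∈ C i) →
      (∀ i ∈ I1, A i ⊆ C i ∨ ∀ j ∈ C i, j ∉ J) → (∃ i ∈ I1, ∃ j ∈ C i, j ∉ J) →
      ∃ C ∈ M, (∀ i ∈ S, ∀ j, g i j ≠ 0 → j ∈ C i) ∧
        ∃ i ∈ S, i ∈ I ∧ ∃ j ∈ C i, j ∉ J := by
    intro m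
    induction m using Nat.strong_induction_on with
    | _ m ih =>
    intro C hC hm h1 h2 h3
    by_cases hl : ∀ i ∈ I1, A i ⊆ C i
    · refine ⟨C, hC, ?_, ?_⟩
      · intro i hi j hij
        by_cases hi1 : i ∈ I1
        · exact hl i hi1 (hg i hi j hij)
        · exact h1 i hi hi1 j hij
      · obtain ⟨i, hi, h4⟩ := h3
        simp only [hI1, Finset.mem_filter] at hi
        exact ⟨i, hi.1, hi.2.1, h4⟩
    · push Not at hl
      obtain ⟨i0, hi0, hl0⟩ := hl
      have hi0S : i0 ∈ S := (Finset.mem_filter.1 hi0).1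
      obtain ⟨D, hD, hD0, hDi⟩ := h.elim A hA C hC i0 hi0S
      refine ih _ ?_ D hD rfl ?_ ?_ ?_
      · rw [← hm]
        apply Finset.card_lt_card
        refine Finset.ssubset_iff_subset_ne.2 ⟨?_, ?_⟩
        · intro i hi
          rw [Finset.mem_filter] at hi ⊢
          refine ⟨hi.1, fun hAC => hi.2 ?_⟩
          rcases hDi i (Finset.mem_filter.1 hi.1).1 with e | e | e <;> rw [e]
          · exact hAC
          · exact Finset.subset_union_left
        · intro e
          have : i0 ∈ I1.filter fun i => ¬ A i ⊆ C i := Finset.mem_filter.2 ⟨hi0, hl0⟩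
          rw [← e, Finset.mem_filter, hD0] at this
          exact this.2 Finset.subset_union_left
      · intro i hi hi1 j hij
        rcases hDi i hi with e | e | e <;> rw [e]
        · exact hg i hi j hij
        · exact h1 i hi hi1 j hij
        · exact Finset.mem_union_left _ (hg i hi j hij)
      · intro i hi
        rcases hDi i (Finset.mem_filter.1 hi).1 with e | e | e <;> rw [e]
        · exact Or.inl subset_rfl
        · exact h2 i hi
        · exact Or.inl Finset.subset_union_left
      · obtain ⟨j, hj⟩ := h.ne C hC i0 hi0S
        refine ⟨i0, hi0, j, ?_, ((h2 i0 hi0).resolve_left hl0) j hj⟩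
        rw [hD0]; exact Finset.mem_union_right _ hj
  refine main _ B hB.1 rfl (fun i hi hi1 => hgB i (Finset.mem_sdiff.2 ⟨hi, hi1⟩))
    (fun i hi => Or.inr (hBI1 i hi)) ?_
  obtain ⟨i, hi, h1⟩ := hex
  have hi1 : i ∈ I1 := Finset.mem_filter.2 ⟨hi, h1⟩
  obtain ⟨j, hj⟩ := h.ne B hB.1 i hi
  exact ⟨i, hi1, j, hj, hBI1 i hi1 j hj⟩

/-- partial flows supported in `A`. -/
structure Feas {n d : ℕ} (S : Finset (Fin n)) (f : Fin n → Fin d → ℝ)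
    (A : Fin n → Finset (Fin d)) (g : Fin n → Fin d → ℝ) : Prop where
  nn : ∀ i j, 0 ≤ g i j
  off : ∀ i, i ∉ S → ∀ j, g i j = 0
  supp : ∀ i ∈ S, ∀ j, j ∉ A i → g i j = 0
  row : ∀ i ∈ S, ∑ j, g i j ≤ ∑ j, f i j
  col : ∀ j, ∑ i ∈ S, g i j ≤ ∑ i ∈ S, f i j

lemma feas_compact {n d : ℕ} (S : Finset (Fin n)) (f : Fin n → Fin d → ℝ)
    (A : Fin n → Finset (Fin d)) : IsCompact {g | Feas S f A g} := by
  have hc : ∀ i j, Continuous fun g : Fin n → Fin d → ℝ => g i j := fun i j => by fun_prop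
  have hclosed : IsClosed {g | Feas S f A g} := by
    have e : {g | Feas S f A g} =
        (⋂ i, ⋂ j, {g | 0 ≤ g i j}) ∩ (⋂ i, ⋂ (_ : i ∉ S), ⋂ j, {g | g i j = 0}) ∩
        (⋂ i, ⋂ (_ : i ∈ S), ⋂ j, ⋂ (_ : j ∉ A i), {g | g i j = 0}) ∩
        (⋂ i, ⋂ (_ : i ∈ S), {g | ∑ j, g i j ≤ ∑ j, f i j}) ∩
        (⋂ j, {g | ∑ i ∈ S, g i j ≤ ∑ i ∈ S, f i j}) := by
      ext g
      simp only [Set.mem_ofPred_eq, Set.mem_inter_iff, Set.mem_iInter]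
      constructor
      · rintro ⟨a, b, c, d, e⟩; exact ⟨⟨⟨⟨a, b⟩, c⟩, d⟩, e⟩
      · rintro ⟨⟨⟨⟨a, b⟩, c⟩, d⟩, e⟩; exact ⟨a, b, c, d, e⟩
    rw [e]
    refine (((IsClosed.inter ?_ ?_).inter ?_).inter ?_).inter ?_
    · exact isClosed_iInter fun i => isClosed_iInter fun j =>
        isClosed_le continuous_const (hc i j)
    · exact isClosed_iInter fun i => isClosed_iInter fun _ => isClosed_iInter fun j =>
        isClosed_eq (hc i j) continuous_const
    · exact isClosed_iInter fun i => isClosed_iInter fun _ => isClosed_iInter fun j =>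
        isClosed_iInter fun _ => isClosed_eq (hc i j) continuous_const
    · exact isClosed_iInter fun i => isClosed_iInter fun _ =>
        isClosed_le (by fun_prop) continuous_const
    · exact isClosed_iInter fun j => isClosed_le (by fun_prop) continuous_const
  have hsub : {g | Feas S f A g} ⊆ Set.univ.pi fun i => Set.univ.pi fun _ : Fin d =>
      Set.Icc (0 : ℝ) (|∑ j, f i j|) := by
    intro g hg i _ j _
    refine ⟨hg.nn i j, ?_⟩
    by_cases hi : i ∈ S
    · calc g i j ≤ ∑ j, g i j :=
            Finset.single_le_sum (f := g i) (fun j _ => hg.nn i j) (Finset.mem_univ j)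
        _ ≤ ∑ j, f i j := hg.row i hi
        _ ≤ _ := le_abs_self _
    · rw [hg.off i hi j]; exact abs_nonneg _
  exact IsCompact.of_isClosed_subset
    (isCompact_univ_pi fun i => isCompact_univ_pi fun _ => isCompact_Icc) hclosed hsub

/-- indicator of an entry. -/
def ent {n d : ℕ} (a : Fin n) (b : Fin d) (ε : ℝ) : Fin n → Fin d → ℝ :=
  fun i j => if i = a then (if j = b then ε else 0) else 0

lemma ent_row {n d : ℕ} (a : Fin n) (b : Fin d) (ε : ℝ) (i : Fin n) :
    ∑ j, ent a b ε i j = if i = a then ε else 0 := by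
  unfold ent
  split_ifs <;> simp

lemma ent_col {n d : ℕ} {S : Finset (Fin n)} {a : Fin n} (ha : a ∈ S) (b : Fin d) (ε : ℝ)
    (j : Fin d) : ∑ i ∈ S, ent a b ε i j = if j = b then ε else 0 := by
  unfold ent
  rw [Finset.sum_ite_eq' S a]
  simp [ha]

lemma core {n d : ℕ} {S : Finset (Fin n)} {G : Fin n → Finset (Fin d)}
    {M : Set (Fin n → Finset (Fin d))} (h : T S G M)
    (IH : ∀ S' : Finset (Fin n), S' ⊂ S → WC (d := d) S')
    {f : Fin n → Fin d → ℝ} (f0 : ∀ i j, 0 ≤ f i j)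
    (hf : ∀ i ∈ S, ∀ j, f i j ≠ 0 → j ∈ G i)
    (hpos : ∀ i ∈ S, ∀ j ∈ G i, 0 < ∑ i ∈ S, f i j) :
    ∃ A ∈ M, ∃ g : Fin n → Fin d → ℝ, (∀ i j, 0 ≤ g i j) ∧
      (∀ i ∈ S, ∀ j, g i j ≠ 0 → j ∈ A i) ∧
      (∀ i ∈ S, ∑ j, g i j = ∑ j, f i j) ∧ (∀ j, ∑ i ∈ S, g i j = ∑ i ∈ S, f i j) := by
  classical
  by_contra hno
  obtain ⟨m, ⟨A0, hA0, g00, hF00, hm0⟩, hmax⟩ : ∃ m : ℝ,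
      (∃ A ∈ M, ∃ g, Feas S f A g ∧ ∑ i ∈ S, ∑ j, g i j = m) ∧
      ∀ A ∈ M, ∀ g, Feas S f A g → ∑ i ∈ S, ∑ j, g i j ≤ m := by
    have hK : IsCompact (⋃ A ∈ M, {g | Feas S f A g}) :=
      (Set.toFinite M).isCompact_biUnion fun A _ => feas_compact S f A
    obtain ⟨B, hB, -⟩ := h.bdry fun _ => 0
    have hne : (⋃ A ∈ M, {g | Feas S f A g}).Nonempty := by
      refine ⟨0, Set.mem_biUnion hB ⟨fun _ _ => le_rfl, fun _ _ _ => rfl, fun _ _ _ _ => rfl,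
        fun i _ => ?_, fun j => ?_⟩⟩
      · simpa using Finset.sum_nonneg fun j _ => f0 i j
      · simpa using Finset.sum_nonneg fun i _ => f0 i j
    have hcont : Continuous fun g : Fin n → Fin d → ℝ => ∑ i ∈ S, ∑ j, g i j := by fun_prop
    obtain ⟨g, hg, hmx⟩ := hK.exists_isMaxOn hne hcont.continuousOn
    simp only [Set.mem_iUnion, Set.mem_ofPred_eq] at hg
    obtain ⟨A, hA, hF⟩ := hg
    exact ⟨_, ⟨A, hA, g, hF, rfl⟩, fun A' hA' g' hF' => hmx (Set.mem_biUnion hA' hF')⟩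
  let U : (Fin n → Fin d → ℝ) → Finset (Fin n) := fun g =>
    S.filter fun i => ∑ j, g i j < ∑ j, f i j
  let N : (Fin n → Finset (Fin d)) → (Fin n → Fin d → ℝ) → Finset (Fin d) := fun A g =>
    Finset.univ.filter fun j => ∃ i ∈ U g, j ∈ A i
  let μ : (Fin n → Finset (Fin d)) → (Fin n → Fin d → ℝ) → ℕ := fun A g =>
    (U g).card * (d + 1) + (N A g).card
  have hNd : ∀ A g, (N A g).card ≤ d := fun A g => by
    simpa using Finset.card_le_univ (N A g)
  have hUn : ∀ g, (U g).card ≤ n := fun g => by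
    simpa using Finset.card_le_univ (U g)
  obtain ⟨A, hA, g, hF, hm, hμ⟩ : ∃ A ∈ M, ∃ g, Feas S f A g ∧ ∑ i ∈ S, ∑ j, g i j = m ∧
      ∀ A' ∈ M, ∀ g', Feas S f A' g' → ∑ i ∈ S, ∑ j, g' i j = m → μ A' g' ≤ μ A g := by
    have hb : ∀ A g, μ A g ≤ n * (d + 1) + d := fun A g =>
      Nat.add_le_add (Nat.mul_le_mul_right _ (hUn g)) (hNd A g)
    let P : ℕ → Prop := fun k => ∃ A ∈ M, ∃ g, Feas S f A g ∧
      ∑ i ∈ S, ∑ j, g i j = m ∧ μ A g = k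
    have hP : P (Nat.findGreatest P (n * (d + 1) + d)) :=
      Nat.findGreatest_spec (hb A0 g00) ⟨A0, hA0, g00, hF00, hm0, rfl⟩
    obtain ⟨A, hA, g, hF, hm, he⟩ := hP
    refine ⟨A, hA, g, hF, hm, fun A' hA' g' hF' hm' => ?_⟩
    rw [he]
    exact Nat.le_findGreatest (hb A' g') ⟨A', hA', g', hF', hm', rfl⟩
  have hUmax : ∀ A' ∈ M, ∀ g', Feas S f A' g' → ∑ i ∈ S, ∑ j, g' i j = m →
      (U g').card ≤ (U g).card := by
    intro A' hA' g' hF' hm'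
    have h1 := hμ A' hA' g' hF' hm'
    have h2 := hNd A g
    by_contra hlt
    push Not at hlt
    have h3 : ((U g).card + 1) * (d + 1) ≤ (U g').card * (d + 1) := Nat.mul_le_mul_right _ hlt
    simp only [μ] at h1
    have h4 : ((U g).card + 1) * (d + 1) = (U g).card * (d + 1) + (d + 1) := by ring
    omega
  have gA : ∀ i ∈ S, ∀ j, g i j ≠ 0 → j ∈ A i := fun i hi j hij => by
    by_contra hj
    exact hij (hF.supp i hi j hj)
  have hUne : (U g).Nonempty := by
    by_contra hU
    rw [Finset.not_nonempty_iff_eq_empty] at hU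
    have hrow : ∀ i ∈ S, ∑ j, g i j = ∑ j, f i j := by
      intro i hi
      apply le_antisymm (hF.row i hi)
      by_contra hlt
      push Not at hlt
      have : i ∈ U g := Finset.mem_filter.2 ⟨hi, hlt⟩
      rw [hU] at this
      simp at this
    apply hno
    refine ⟨A, hA, g, hF.nn, gA, hrow, ?_⟩
    have e : ∑ j, ∑ i ∈ S, g i j = ∑ j, ∑ i ∈ S, f i j := by
      rw [Finset.sum_comm, Finset.sum_comm (f := fun j i => f i j)]
      exact Finset.sum_congr rfl hrow
    have := (Finset.sum_eq_sum_iff_of_le (fun j _ => hF.col j)).1 e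
    exact fun j => this j (Finset.mem_univ j)
  set J := N A g with hJ
  have hsat : ∀ j ∈ J, ∑ i ∈ S, g i j = ∑ i ∈ S, f i j := by
    intro j hj
    obtain ⟨i, hi, hij⟩ := (Finset.mem_filter.1 hj).2
    obtain ⟨hiS, hilt⟩ := Finset.mem_filter.1 hi
    apply le_antisymm (hF.col j)
    by_contra hlt
    push Not at hlt
    set ε := min (∑ j, f i j - ∑ j, g i j) (∑ i ∈ S, f i j - ∑ i ∈ S, g i j) with hε
    have e0 : 0 < ε := lt_min (by linarith) (by linarith)
    have e1 : ε ≤ ∑ j, f i j - ∑ j, g i j := min_le_left _ _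
    have e2 : ε ≤ ∑ i ∈ S, f i j - ∑ i ∈ S, g i j := min_le_right _ _
    have hF' : Feas S f A (fun a b => g a b + ent i j ε a b) := by
      refine ⟨?_, ?_, ?_, ?_, ?_⟩
      · intro a b
        have := hF.nn a b
        unfold ent
        split_ifs <;> linarith
      · intro a ha b
        have : a ≠ i := fun e => ha (e ▸ hiS)
        simp [ent, this, hF.off a ha b]
      · intro a ha b hb
        have : ent i j ε a b = 0 := by
          unfold ent
          split_ifs with h1 h2
          · subst h1 h2; exact absurd hij hb
          · rfl
          · rfl
        simp [this, hF.supp a ha b hb]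
      · intro a ha
        rw [Finset.sum_add_distrib, ent_row]
        have := hF.row a ha
        split_ifs with h1
        · subst h1; linarith
        · linarith
      · intro b
        rw [Finset.sum_add_distrib, ent_col hiS]
        have := hF.col b
        split_ifs with h1
        · subst h1; linarith
        · linarith
    have := hmax A hA _ hF'
    simp only [Finset.sum_add_distrib, ent_row, hm, Finset.sum_ite_eq', hiS, if_true] at this
    linarith
  have hinto : ∀ i' ∈ S, ∀ j ∈ J, g i' j ≠ 0 → i' ∈ U g := by
    intro i' hi' j hj hne
    by_contra hnU
    obtain ⟨i, hi, hij⟩ := (Finset.mem_filter.1 hj).2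
    obtain ⟨hiS, hilt⟩ := Finset.mem_filter.1 hi
    have hii : i ≠ i' := fun e => hnU (e ▸ hi)
    have hgp : 0 < g i' j := lt_of_le_of_ne (hF.nn i' j) (Ne.symm hne)
    set ε := min ((∑ j, f i j - ∑ j, g i j) / 2) (g i' j) with hε
    have e0 : 0 < ε := lt_min (by linarith) hgp
    have e1 : ε ≤ (∑ j, f i j - ∑ j, g i j) / 2 := min_le_left _ _
    have e2 : ε ≤ g i' j := min_le_right _ _
    have hF' : Feas S f A (fun a b => g a b + (ent i j ε a b - ent i' j ε a b)) := by
      refine ⟨?_, ?_, ?_, ?_, ?_⟩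
      · intro a b
        have := hF.nn a b
        unfold ent
        by_cases h1 : a = i'
        · by_cases h2 : b = j
          · subst h1 h2
            simp [hii.symm]
            linarith
          · simp [h2, this]
        · simp only [h1, if_false]
          split_ifs <;> linarith
      · intro a ha b
        have h1 : a ≠ i := fun e => ha (e ▸ hiS)
        have h2 : a ≠ i' := fun e => ha (e ▸ hi')
        simp [ent, h1, h2, hF.off a ha b]
      · intro a ha b hb
        have h1 : ent i j ε a b = 0 := by
          unfold ent
          split_ifs with h1 h2
          · subst h1 h2; exact absurd hij hb
          · rfl
          · rfl
        have h2 : ent i' j ε a b = 0 := by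
          unfold ent
          split_ifs with h1 h2
          · subst h1 h2; exact absurd (gA _ ha _ hne) hb
          · rfl
          · rfl
        simp [h1, h2, hF.supp a ha b hb]
      · intro a ha
        rw [Finset.sum_add_distrib, Finset.sum_sub_distrib, ent_row, ent_row]
        have := hF.row a ha
        by_cases h1 : a = i
        · subst h1
          simp [hii]
          linarith
        · simp only [h1, if_false]
          split_ifs <;> linarith
      · intro b
        rw [Finset.sum_add_distrib, Finset.sum_sub_distrib, ent_col hiS, ent_col hi']
        have := hF.col b
        linarith
    have htot : ∑ a ∈ S, ∑ b, (g a b + (ent i j ε a b - ent i' j ε a b)) = m := by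
      simp only [Finset.sum_add_distrib, Finset.sum_sub_distrib, ent_row, hm,
        Finset.sum_ite_eq', hiS, hi', if_true]
      ring
    have hle := hUmax A hA _ hF' htot
    have hlt : (U g).card < (U fun a b => g a b + (ent i j ε a b - ent i' j ε a b)).card := by
      apply Finset.card_lt_card
      refine Finset.ssubset_iff_of_subset ?_ |>.2 ⟨i', ?_, hnU⟩
      · intro a ha
        have hai : a ≠ i' := fun e => hnU (e ▸ ha)
        rw [Finset.mem_filter] at ha ⊢
        refine ⟨ha.1, ?_⟩
        rw [Finset.sum_add_distrib, Finset.sum_sub_distrib, ent_row, ent_row]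
        simp only [hai, if_false]
        split_ifs with h1
        · subst h1; linarith
        · linarith [ha.2]
      · rw [Finset.mem_filter]
        refine ⟨hi', ?_⟩
        rw [Finset.sum_add_distrib, Finset.sum_sub_distrib, ent_row, ent_row]
        have := hF.row i' hi'
        simp only [hii.symm, if_false, if_true]
        linarith
    omega
  have hUS : U g ⊆ S := Finset.filter_subset _ _
  have hex : ∃ i ∈ S, i ∈ U g ∧ ∃ j ∈ G i, j ∉ J := by
    by_contra hcon
    push Not at hcon
    have c1 : ∑ i ∈ U g, ∑ j, g i j < ∑ i ∈ U g, ∑ j, f i j :=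
      Finset.sum_lt_sum_of_nonempty hUne fun i hi => (Finset.mem_filter.1 hi).2
    have c2 : ∀ i ∈ U g, ∑ j, f i j = ∑ j ∈ J, f i j := by
      intro i hi
      symm
      apply Finset.sum_subset (Finset.subset_univ _)
      intro j _ hj
      by_contra hne
      exact hj (hcon i (hUS hi) hi j (hf i (hUS hi) j hne))
    have c3 : ∑ i ∈ U g, ∑ j, f i j ≤ ∑ j ∈ J, ∑ i ∈ S, f i j := by
      rw [Finset.sum_congr rfl c2, Finset.sum_comm]
      exact Finset.sum_le_sum fun j _ =>
        Finset.sum_le_sum_of_subset_of_nonneg hUS fun i _ _ => f0 i j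
    have c4 : ∑ j ∈ J, ∑ i ∈ S, g i j = ∑ j ∈ J, ∑ i ∈ U g, g i j := by
      refine Finset.sum_congr rfl fun j hj => ?_
      symm
      apply Finset.sum_subset hUS
      intro i hi hiU
      by_contra hne
      exact hiU (hinto i hi j hj hne)
    have c5 : ∑ j ∈ J, ∑ i ∈ U g, g i j ≤ ∑ i ∈ U g, ∑ j, g i j := by
      rw [Finset.sum_comm]
      exact Finset.sum_le_sum fun i _ =>
        Finset.sum_le_sum_of_subset_of_nonneg (Finset.subset_univ _) fun j _ _ => hF.nn i j
    have c6 : ∑ j ∈ J, ∑ i ∈ S, g i j = ∑ j ∈ J, ∑ i ∈ S, f i j :=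
      Finset.sum_congr rfl hsat
    linarith
  obtain ⟨C, hC, hgC, i, hi, hiU, j, hjC, hjJ⟩ := ext_step h IH hA hF.nn gA (U g) J
    (fun i hi hiU j hij hj => hiU (hinto i hi j hj hij)) hex
  have hFC : Feas S f C g := ⟨hF.nn, hF.off, fun i hi j hj => by
    by_contra hne
    exact hj (hgC i hi j hne), hF.row, hF.col⟩
  have hle := hμ C hC g hFC hm
  have hlt : J.card < (N C g).card := by
    apply Finset.card_lt_card
    refine Finset.ssubset_iff_of_subset ?_ |>.2 ⟨j, ?_, hjJ⟩
    · intro b hb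
      obtain ⟨a, ha, hab⟩ := (Finset.mem_filter.1 hb).2
      have hp : 0 < ∑ i ∈ S, g i b := by
        rw [hsat b hb]
        exact hpos a (hUS ha) b (h.sub A hA a (hUS ha) hab)
      obtain ⟨c, hc, hcb⟩ := Finset.exists_ne_zero_of_sum_ne_zero hp.ne'
      exact Finset.mem_filter.2 ⟨Finset.mem_univ _, c, hinto c hc b hb hcb, hgC c hc b hcb⟩
    · exact Finset.mem_filter.2 ⟨Finset.mem_univ _, i, hiU, hjC⟩
  simp only [μ] at hle
  rw [hJ] at hlt
  omega

theorem wc {n d : ℕ} (S : Finset (Fin n)) : WC (d := d) S := by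
  classical
  induction S using Finset.strongInduction with
  | H S IH =>
  intro G M h f f0 hf
  set S0 := S.filter fun i => ∃ j, f i j ≠ 0 with hS0
  set Y : Finset (Fin d) := Finset.univ.filter fun j => 0 < ∑ i ∈ S0, f i j with hY
  have hsub : S0 ⊆ S := Finset.filter_subset _ _
  have hT := (h.mono hsub).ref Y
  have hfY : ∀ i ∈ S0, ∀ j, f i j ≠ 0 → j ∈ G i ∩ Y := by
    intro i hi j hij
    rw [Finset.mem_inter]
    refine ⟨hf i (hsub hi) j hij, Finset.mem_filter.2 ⟨Finset.mem_univ _, ?_⟩⟩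
    exact Finset.sum_pos' (fun a _ => f0 a j) ⟨i, hi, lt_of_le_of_ne (f0 i j) hij.symm⟩
  have href : ∀ i ∈ S0, ref G Y i = G i ∩ Y := by
    intro i hi
    obtain ⟨j, hj⟩ := (Finset.mem_filter.1 hi).2
    exact if_pos ⟨j, hfY i hi j hj⟩
  obtain ⟨A, hA, g, g0, hg, hr, hc⟩ := core hT (fun S' hS' => IH S' (hS'.trans_subset hsub)) f0
    (fun i hi j hij => by rw [href i hi]; exact hfY i hi j hij)
    (fun i hi j hj => by
      rw [href i hi] at hj
      exact (Finset.mem_filter.1 (Finset.mem_inter.1 hj).2).2)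
  have hz : ∀ i ∈ S, i ∉ S0 → ∀ j, f i j = 0 := by
    intro i hi hn j
    by_contra hne
    exact hn (Finset.mem_filter.2 ⟨hi, j, hne⟩)
  refine ⟨A, hA.1, fun i j => if i ∈ S0 then g i j else 0, ?_, ?_, ?_, ?_⟩
  · intro i j
    dsimp only
    split_ifs
    · exact g0 i j
    · exact le_rfl
  · intro i hi j hij
    by_cases h0 : i ∈ S0
    · simp only [h0, if_true] at hij; exact hg i h0 j hij
    · simp [h0] at hij
  · intro i hi
    by_cases h0 : i ∈ S0
    · simp only [h0, if_true]; exact hr i h0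
    · simp [h0, hz i hi h0]
  · intro j
    have e1 : ∑ i ∈ S, f i j = ∑ i ∈ S0, f i j := by
      symm
      exact Finset.sum_subset hsub fun i hi hn => hz i hi hn j
    have e2 : ∑ i ∈ S, (if i ∈ S0 then g i j else 0) = ∑ i ∈ S0, g i j := by
      rw [← Finset.sum_filter]
      congr 1
      ext a
      simp only [Finset.mem_filter]
      exact ⟨fun h => h.2, fun h => ⟨hsub h, h⟩⟩
    rw [e1, e2, hc j]

lemma T_of_gtom {n d : ℕ} {G : Finset (Fin n × Fin d)} {M : Set (Fin n → Finset (Fin d))}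
    (hG : ∀ i, ∃ j, (i, j) ∈ G) (hM : IsGTOM G M) : T Finset.univ (graphType G) M where
  ne A hA i _ := hM.isType A hA i
  sub A hA i _ j hj := by
    have : (i, j) ∈ typeEdges A := hj
    simpa [graphType] using hM.subgraph A hA this
  bdry ρ := by
    classical
    set σ := (Tuple.sort ρ)⁻¹ with hσ
    have hmono : ∀ j j', σ j ≤ σ j' → ρ j ≤ ρ j' := by
      intro j j' hjj
      have := Tuple.monotone_sort ρ hjj
      simpa [hσ] using this
    have hex : ∀ i, ∃ j ∈ graphType G i, ∀ j' ∈ graphType G i, σ j ≤ σ j' := by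
      intro i
      obtain ⟨j, hj⟩ := hG i
      exact Finset.exists_min_image _ _ ⟨j, by simp [graphType, hj]⟩
    choose m hm hmin using hex
    refine ⟨fun i => {m i}, hM.boundary σ _ fun i => ⟨m i, hm i, rfl, hmin i⟩, ?_⟩
    intro i _ j hj j' hj'
    rw [Finset.mem_singleton] at hj
    subst hj
    exact hmono _ _ (hmin i j' hj')
  pot A hA B hB := by
    obtain ⟨u, v, h1, h2, h3, -⟩ := exists_potential (hM.comparability A hA B hB)
      (hM.comparability B hB A hA)
    exact ⟨u, v, h1, h2, h3⟩
  elim A hA B hB i _ := by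
    obtain ⟨C, hC, h1, h2⟩ := hM.elimination A hA B hB i
    exact ⟨C, hC, h1, fun i' _ => h2 i'⟩

lemma mem_rootPoly {n d : ℕ} (S : Set (Fin n × Fin d)) (p : (Fin n → ℝ) × (Fin d → ℝ)) :
    p ∈ rootPoly S ↔ ∃ g : Fin n → Fin d → ℝ, (∀ i j, 0 ≤ g i j) ∧
      (∀ i j, g i j ≠ 0 → (i, j) ∈ S) ∧ ∑ i, ∑ j, g i j = 1 ∧
      (∀ i, p.1 i = ∑ j, g i j) ∧ (∀ j, p.2 j = ∑ i, g i j) := by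
  classical
  constructor
  · intro hp
    have hconv : Convex ℝ {p : (Fin n → ℝ) × (Fin d → ℝ) | ∃ g : Fin n → Fin d → ℝ,
        (∀ i j, 0 ≤ g i j) ∧
        (∀ i j, g i j ≠ 0 → (i, j) ∈ S) ∧ ∑ i, ∑ j, g i j = 1 ∧
        (∀ i, p.1 i = ∑ j, g i j) ∧ (∀ j, p.2 j = ∑ i, g i j)} := by
      rintro p ⟨g, g0, gS, g1, gr, gc⟩ q ⟨k, k0, kS, k1, kr, kc⟩ a b ha hb hab
      refine ⟨fun i j => a * g i j + b * k i j, ?_, ?_, ?_, ?_, ?_⟩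
      · intro i j
        exact add_nonneg (mul_nonneg ha (g0 i j)) (mul_nonneg hb (k0 i j))
      · intro i j hne
        by_contra hn
        have h1 : g i j = 0 := by
          by_contra h; exact hn (gS i j h)
        have h2 : k i j = 0 := by
          by_contra h; exact hn (kS i j h)
        simp [h1, h2] at hne
      · simp only [Finset.sum_add_distrib, ← Finset.mul_sum, g1, k1]
        linarith
      · intro i
        simp [Finset.sum_add_distrib, ← Finset.mul_sum, gr, kr]
      · intro j
        simp [Finset.sum_add_distrib, ← Finset.mul_sum, gc, kc]
    refine convexHull_min ?_ hconv hp
    rintro _ ⟨⟨i, j⟩, hij, rfl⟩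
    refine ⟨ent i j 1, ?_, ?_, ?_, ?_, ?_⟩
    · intro a b
      unfold ent
      split_ifs <;> norm_num
    · intro a b hne
      unfold ent at hne
      split_ifs at hne with h1 h2
      · subst h1 h2; exact hij
      · exact absurd rfl hne
      · exact absurd rfl hne
    · simp [ent_row]
    · intro a
      simp [ent_row, rootVert, Pi.single_apply]
    · intro b
      simp [ent_col (Finset.mem_univ i), rootVert, Pi.single_apply]
  · rintro ⟨g, g0, gS, g1, gr, gc⟩
    have e : p = ∑ q ∈ Finset.univ.filter (fun q : Fin n × Fin d => g q.1 q.2 ≠ 0),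
        g q.1 q.2 • rootVert q := by
      rw [Finset.sum_filter_of_ne (fun q _ h => by
        intro h0; apply h; rw [h0, zero_smul])]
      ext a
      · rw [gr a, Prod.fst_sum, Finset.sum_apply, Fintype.sum_prod_type]
        simp [rootVert, Pi.single_apply]
      · rw [gc a, Prod.snd_sum, Finset.sum_apply, Fintype.sum_prod_type]
        simp [rootVert, Pi.single_apply]
    rw [e]
    refine (convex_convexHull ℝ _).sum_mem (fun q _ => g0 _ _) ?_ ?_
    · rw [Finset.sum_filter_ne_zero, Fintype.sum_prod_type]
      exact g1
    · intro q hq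
      exact subset_convexHull ℝ _ ⟨q, gS _ _ (Finset.mem_filter.1 hq).2, rfl⟩

/-- the linear functional of a pair of potentials. -/
def ell {n d : ℕ} (u : Fin n → ℝ) (v : Fin d → ℝ) (p : (Fin n → ℝ) × (Fin d → ℝ)) : ℝ :=
  ∑ i, u i * p.1 i - ∑ j, v j * p.2 j

lemma extreme_of_compat {n d : ℕ} {S T : Set (Fin n × Fin d)} (h : Compatible S T)
    (h' : Compatible T S) : IsExtreme ℝ (rootPoly S) (rootPoly S ∩ rootPoly T) := by
  obtain ⟨u, v, hS, hT, hST, -⟩ := exists_potential h h'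
  have hell : ∀ (p : (Fin n → ℝ) × (Fin d → ℝ)) (g : Fin n → Fin d → ℝ),
      (∀ i, p.1 i = ∑ j, g i j) → (∀ j, p.2 j = ∑ i, g i j) →
      ell u v p = ∑ i, ∑ j, g i j * (u i - v j) := by
    intro p g hr hc
    rw [pot_sum]
    simp only [ell, hr, hc]
  have t1 : ∀ g : Fin n → Fin d → ℝ, (∀ i j, 0 ≤ g i j) → (∀ i j, g i j ≠ 0 → (i, j) ∈ S) →
      ∀ i j, 0 ≤ g i j * (u i - v j) := by
    intro g g0 gS i j
    by_cases h : g i j = 0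
    · simp [h]
    · exact mul_nonneg (g0 i j) (sub_nonneg.2 (hS i j (gS i j h)))
  have pos : ∀ p ∈ rootPoly S, 0 ≤ ell u v p := by
    intro p hp
    obtain ⟨g, g0, gS, g1, gr, gc⟩ := (mem_rootPoly S p).1 hp
    rw [hell p g gr gc]
    exact Finset.sum_nonneg fun i _ => Finset.sum_nonneg fun j _ => t1 g g0 gS i j
  have neg : ∀ p ∈ rootPoly T, ell u v p ≤ 0 := by
    intro p hp
    obtain ⟨g, g0, gT, g1, gr, gc⟩ := (mem_rootPoly T p).1 hp
    rw [hell p g gr gc]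
    refine Finset.sum_nonpos fun i _ => Finset.sum_nonpos fun j _ => ?_
    by_cases h : g i j = 0
    · simp [h]
    · exact mul_nonpos_of_nonneg_of_nonpos (g0 i j) (sub_nonpos.2 (hT i j (gT i j h)))
  have zero : ∀ p ∈ rootPoly S, ell u v p = 0 → p ∈ rootPoly T := by
    intro p hp hz
    obtain ⟨g, g0, gS, g1, gr, gc⟩ := (mem_rootPoly S p).1 hp
    rw [hell p g gr gc] at hz
    refine (mem_rootPoly T p).2 ⟨g, g0, fun i j hij => ?_, g1, gr, gc⟩
    have z1 := (Finset.sum_eq_zero_iff_of_nonneg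
      (fun i _ => Finset.sum_nonneg fun j _ => t1 g g0 gS i j)).1 hz i (Finset.mem_univ i)
    have z2 := (Finset.sum_eq_zero_iff_of_nonneg
      (fun j _ => t1 g g0 gS i j)).1 z1 j (Finset.mem_univ j)
    have z3 : u i - v j = 0 := (mul_eq_zero.1 z2).resolve_left hij
    exact hST i j (gS i j hij) (by linarith)
  have lin : ∀ (a b : ℝ) (p q : (Fin n → ℝ) × (Fin d → ℝ)),
      ell u v (a • p + b • q) = a * ell u v p + b * ell u v q := by
    intro a b p q
    simp only [ell, Prod.fst_add, Prod.snd_add, Prod.smul_fst, Prod.smul_snd, Pi.add_apply,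
      Pi.smul_apply, smul_eq_mul, mul_sub, Finset.mul_sum, mul_add, Finset.sum_add_distrib]
    simp only [mul_left_comm]
    ring
  refine ⟨Set.inter_subset_left, ?_⟩
  rintro x hx y hy z ⟨-, hz⟩ ⟨a, b, ha, hb, hab, rfl⟩
  have hn := neg _ hz
  rw [lin] at hn
  have px := pos x hx
  have py := pos y hy
  have : ell u v x = 0 := by
    have h1 : 0 ≤ b * ell u v y := mul_nonneg hb.le py
    have h2 : a * ell u v x ≤ 0 := by linarith
    have h3 : ell u v x ≤ 0 := by
      by_contra hc
      push Not at hc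
      have := mul_pos ha hc
      linarith
    linarith
  exact ⟨hx, zero x hx this⟩

lemma exists_conn {n d : ℕ} (hn : 0 < n) {G : Finset (Fin n × Fin d)}
    (hG : IsConn (↑G : Set (Fin n × Fin d)))
    {M : Set (Fin n → Finset (Fin d))} (hT : T Finset.univ (graphType G) M)
    {A : Fin n → Finset (Fin d)} (hA : A ∈ M) :
    ∃ C ∈ M, A ≤ C ∧ IsConn (typeEdges C) := by
  classical
  obtain ⟨C, hAC, hC⟩ := (Set.toFinite M).exists_le_maximal hA
  refine ⟨C, hC.prop, hAC, ?_⟩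
  by_contra hnc
  have hext : ∀ (I : Finset (Fin n)) (J : Finset (Fin d)),
      (∀ i j, j ∈ C i → (i ∈ I ↔ j ∈ J)) →
      (∃ i ∈ I, ∃ j, (i, j) ∈ G ∧ j ∉ J) → False := by
    rintro I J hIJ ⟨i, hi, j, hij, hj⟩
    obtain ⟨D, hD, hCD, i', -, hi', j', hj', hjJ⟩ := ext_step hT (fun S' _ => wc S') hC.prop
      (g := fun i j => if j ∈ C i then 1 else 0)
      (fun i j => by split_ifs <;> norm_num)
      (fun i _ j hij => by
        by_contra h
        simp [h] at hij) I J
      (fun i _ hi j hij hj => by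
        have : j ∈ C i := by
          by_contra h
          simp [h] at hij
        exact hi ((hIJ i j this).2 hj))
      ⟨i, Finset.mem_univ _, hi, j, by simp [graphType, hij], hj⟩
    have hle : C ≤ D := fun a b hb => hCD a (Finset.mem_univ _) b (by simp [hb])
    have hjC : j' ∈ C i' := hC.2 hD hle i' hj'
    exact hjJ ((hIJ i' j' hjC).1 hi')
  have : Nonempty (Fin n ⊕ Fin d) := ⟨Sum.inl ⟨0, hn⟩⟩
  have hnp : ¬ (bipGraph (typeEdges C)).Preconnected := fun h => hnc ⟨h⟩
  unfold SimpleGraph.Preconnected at hnp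
  push Not at hnp
  obtain ⟨w, w', hww⟩ := hnp
  set R : Fin n ⊕ Fin d → Prop := fun z => (bipGraph (typeEdges C)).Reachable w z with hR
  have hadj : ∀ i j, j ∈ C i → (R (Sum.inl i) ↔ R (Sum.inr j)) := by
    intro i j hij
    have ha : (bipGraph (typeEdges C)).Adj (Sum.inl i) (Sum.inr j) :=
      ⟨i, j, hij, Or.inl ⟨rfl, rfl⟩⟩
    exact ⟨fun h => h.trans ha.reachable, fun h => h.trans ha.symm.reachable⟩
  by_cases hedge : ∀ i j, (i, j) ∈ G → (R (Sum.inl i) ↔ R (Sum.inr j))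
  · apply hww
    have hwalk : ∀ a b, (bipGraph (↑G : Set (Fin n × Fin d))).Walk a b → R a → R b := by
      intro a b p
      induction p with
      | nil => exact id
      | cons hab _ ih =>
        intro ha
        apply ih
        obtain ⟨i, j, hij, (⟨rfl, rfl⟩ | ⟨rfl, rfl⟩)⟩ := hab
        · exact (hedge i j (by simpa using hij)).1 ha
        · exact (hedge i j (by simpa using hij)).2 ha
    obtain ⟨p⟩ := hG.preconnected w w'
    exact hwalk w w' p (SimpleGraph.Reachable.refl w)
  · push Not at hedge
    obtain ⟨i, j, hij, h | h⟩ := hedge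
    · exact hext (Finset.univ.filter fun i => R (Sum.inl i))
        (Finset.univ.filter fun j => R (Sum.inr j))
        (fun a b hab => by simpa using hadj a b hab)
        ⟨i, by simpa using h.1, j, hij, by simpa using h.2⟩
    · exact hext (Finset.univ.filter fun i => ¬ R (Sum.inl i))
        (Finset.univ.filter fun j => ¬ R (Sum.inr j))
        (fun a b hab => by simpa using not_congr (hadj a b hab))
        ⟨i, by simpa using h.1, j, hij, by simpa using h.2⟩

theorem main {n d : ℕ} (hn : 0 < n) (hd : 0 < d)
    (G : Finset (Fin n × Fin d)) (hGsub : IsConn (↑G : Set (Fin n × Fin d)))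
    (M : Set (Fin n → Finset (Fin d))) (hM : IsGTOM G M) :
    EncodesSubdivision (↑G : Set (Fin n × Fin d))
      {S | ∃ A ∈ M, IsConn (typeEdges A) ∧ S = typeEdges A} := by
  have hG : ∀ i, ∃ j, (i, j) ∈ G := by
    intro i
    obtain ⟨p⟩ := hGsub.preconnected (Sum.inl i) (Sum.inr ⟨0, hd⟩)
    cases p with
    | cons hab _ =>
      obtain ⟨a, b, hab', (⟨h1, h2⟩ | ⟨h1, h2⟩)⟩ := hab
      · rw [Sum.inl.injEq] at h1
        subst h1
        exact ⟨b, by simpa using hab'⟩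
      · simp at h1
  have hT := T_of_gtom hG hM
  refine ⟨?_, ?_⟩
  · apply Set.Subset.antisymm
    · refine Set.iUnion₂_subset ?_
      rintro _ ⟨A, hA, -, rfl⟩
      exact convexHull_mono (Set.image_mono (hM.subgraph A hA))
    · intro p hp
      obtain ⟨f, f0, fG, f1, fr, fc⟩ := (mem_rootPoly _ p).1 hp
      obtain ⟨A, hA, g, g0, gA, gr, gc⟩ := wc Finset.univ (graphType G) M hT f f0
        (fun i _ j hij => by simpa [graphType] using fG i j hij)
      obtain ⟨C, hC, hAC, hconn⟩ := exists_conn hn hGsub hT hA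
      refine Set.mem_biUnion (show typeEdges C ∈ _ from ⟨C, hC, hconn, rfl⟩) ?_
      refine (mem_rootPoly _ p).2 ⟨g, g0, fun i j hij => hAC i (gA i (Finset.mem_univ _) j hij),
        ?_, ?_, ?_⟩
      · rw [← f1]
        exact Finset.sum_congr rfl gr
      · intro i
        rw [fr i, gr i (Finset.mem_univ _)]
      · intro j
        rw [fc j, gc j]
  · rintro _ ⟨A, hA, -, rfl⟩ _ ⟨B, hB, -, rfl⟩
    refine ⟨extreme_of_compat (hM.comparability A hA B hB) (hM.comparability B hB A hA), ?_⟩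
    rw [Set.inter_comm]
    exact extreme_of_compat (hM.comparability B hB A hA) (hM.comparability A hA B hB)

end GTOM

/-- the connected types of a `G`-tropical oriented matroid encode a
polyhedral subdivision of the root polytope `Q_G`. -/
theorem gtom_encodes_subdivision {n d : ℕ} (hn : 0 < n) (hd : 0 < d)
    (G : Finset (Fin n × Fin d)) (hGsub : IsConn (↑G : Set (Fin n × Fin d)))
    (M : Set (Fin n → Finset (Fin d))) (hM : IsGTOM G M) :
    EncodesSubdivision (↑G : Set (Fin n × Fin d))
      {S | ∃ A ∈ M, IsConn (typeEdges A) ∧ S = typeEdges A} := by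
  exact GTOM.main hn hd G hGsub M hM
end

section
/- Let n, d be positive integers, G a connected subgraph of K_{n,d}, and 𝒢 a finite collection of connected subgraphs of G that encodes a polyhedral subdivision of the root polytope Q_G. Then the set M of all refinements A_P, where A ranges over the types of the members of 𝒢 and P ranges over all ordered partitions of Fin d (including the one-part partition, so each member of 𝒢 itself lies in M), is a G-tropical oriented matroid. -/
open Finset Pointwise

/-- `B` consists of the minimizers of the weight `w` in each row of `A`. -/
def IsMinW {n d : ℕ} {α : Type*} [LinearOrder α] (A : Fin n → Finset (Fin d)) (w : Fin d → α)
    (B : Fin n → Finset (Fin d)) : Prop :=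
  ∀ r j, j ∈ B r ↔ j ∈ A r ∧ ∀ k ∈ A r, w j ≤ w k

theorem isRefinement_of_weight {d : ℕ} {α : Type*} [LinearOrder α] (w : Fin d → α) :
    ∃ P : OrderedPartition d, ∀ (n : ℕ) (A B : Fin n → Finset (Fin d)),
      (∀ r, (A r).Nonempty) → IsMinW A w B → IsRefinement A P B := by
  classical
  set I : Finset α := Finset.univ.image w with hI
  let e := I.orderIsoOfFin rfl
  refine ⟨⟨I.card, fun k => Finset.univ.filter fun j => w j = (e k : α), ?_, ?_, ?_⟩, ?_⟩
  · intro k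
    obtain ⟨j, -, hj⟩ := Finset.mem_image.mp (show (e k : α) ∈ Finset.univ.image w from (e k).2)
    exact ⟨j, by simp [hj]⟩
  · intro k l hkl
    rw [Finset.disjoint_left]
    intro j hj hj'
    simp only [Finset.mem_filter, Finset.mem_univ, true_and] at hj hj'
    exact hkl (e.injective (Subtype.ext (hj.symm.trans hj')))
  · intro j
    refine ⟨e.symm ⟨w j, by simp [hI]⟩, by simp⟩
  · intro n A B hA hB r
    obtain ⟨j, hj, hmin⟩ := Finset.exists_min_image (A r) w (hA r)
    refine ⟨e.symm ⟨w j, by simp [hI]⟩, ?_, ?_, ?_⟩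
    · ext k
      simp only [hB r k, Finset.mem_inter, Finset.mem_filter, Finset.mem_univ, true_and,
        OrderIso.apply_symm_apply]
      constructor
      · rintro ⟨h1, h2⟩
        exact ⟨h1, le_antisymm (h2 j hj) (hmin k h1)⟩
      · rintro ⟨h1, h2⟩
        exact ⟨h1, fun k' hk' => h2 ▸ hmin k' hk'⟩
    · exact ⟨j, by simp [hj]⟩
    · intro l hl
      rw [Finset.eq_empty_iff_forall_notMem]
      intro k hk
      simp only [Finset.mem_inter, Finset.mem_filter, Finset.mem_univ, true_and] at hk
      have h1 := hmin k hk.1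
      rw [OrderIso.lt_symm_apply] at hl
      have h2 : (e l : α) < w j := hl
      rw [← hk.2] at h2
      exact absurd h1 (not_le.mpr h2)

theorem weight_of_isRefinement {d : ℕ} (P : OrderedPartition d) :
    ∃ w : Fin d → ℕ, ∀ (n : ℕ) (A B : Fin n → Finset (Fin d)),
      IsRefinement A P B → IsMinW A w B := by
  choose κ hκ using P.covers
  have huniq : ∀ j k, j ∈ P.parts k → κ j = k := by
    intro j k hk
    by_contra hne
    exact (Finset.disjoint_left.mp (P.disjoint _ _ hne)) (hκ j) hk
  refine ⟨fun j => (κ j : ℕ), ?_⟩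
  intro n A B h r j
  obtain ⟨k, hB, ⟨j0, hj0⟩, hlt⟩ := h r
  rw [Finset.mem_inter] at hj0
  have hge : ∀ j' ∈ A r, k ≤ κ j' := by
    intro j' hj'
    by_contra hlt'
    have := hlt (κ j') (not_le.mp hlt')
    have hm : j' ∈ A r ∩ P.parts (κ j') := Finset.mem_inter.mpr ⟨hj', hκ j'⟩
    rw [this] at hm
    simp at hm
  rw [hB, Finset.mem_inter]
  constructor
  · rintro ⟨h1, h2⟩
    refine ⟨h1, fun k' hk' => ?_⟩
    show (κ j : ℕ) ≤ κ k'
    rw [huniq _ _ h2]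
    exact hge k' hk'
  · rintro ⟨h1, h2⟩
    refine ⟨h1, ?_⟩
    have : (κ j : ℕ) ≤ κ j0 := h2 j0 hj0.1
    rw [huniq _ _ hj0.2] at this
    have h3 : κ j = k := le_antisymm this (hge j h1)
    rw [← h3]
    exact hκ j

theorem row_nonempty_of_isConn {n d : ℕ} (hd : 0 < d) (S : Finset (Fin n × Fin d))
    (h : IsConn (↑S : Set (Fin n × Fin d))) (r : Fin n) : (graphType S r).Nonempty := by
  have hr := h.preconnected (Sum.inl r) (Sum.inr ⟨0, hd⟩)
  obtain ⟨p⟩ := hr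
  cases p with
  | cons hadj _ =>
    obtain ⟨a, b, hab, (⟨h1, h2⟩ | ⟨h1, h2⟩)⟩ := hadj
    · cases h1
      exact ⟨b, by simpa [graphType] using hab⟩
    · cases h1

/-- The point with the marginals of the flow `c`. -/
noncomputable def marg {n d : ℕ} (c : Fin n × Fin d → ℝ) : (Fin n → ℝ) × (Fin d → ℝ) :=
  ∑ p, c p • rootVert p

theorem marg_add {n d : ℕ} (a b : Fin n × Fin d → ℝ) : marg (a + b) = marg a + marg b := by
  simp [marg, add_smul, Finset.sum_add_distrib]

theorem marg_smul {n d : ℕ} (t : ℝ) (a : Fin n × Fin d → ℝ) : marg (t • a) = t • marg a := by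
  simp [marg, Finset.smul_sum, mul_smul]

theorem marg_single {n d : ℕ} (p : Fin n × Fin d) :
    marg (Pi.single p 1) = rootVert p := by
  classical
  unfold marg
  rw [Finset.sum_eq_single p]
  · simp
  · intro b _ hb
    simp [hb]
  · simp

theorem marg_functional {n d : ℕ} (c : Fin n × Fin d → ℝ) (u : Fin n → ℝ) (w : Fin d → ℝ) :
    ∑ p, c p * (u p.1 + w p.2) = ∑ r, u r * (marg c).1 r + ∑ j, w j * (marg c).2 j := by
  classical
  have h1 : ∀ r, (marg c).1 r = ∑ p, c p * (if p.1 = r then 1 else 0) := by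
    intro r
    simp [marg, rootVert, Prod.fst_sum, Finset.sum_apply, Pi.single_apply, eq_comm]
  have h2 : ∀ j, (marg c).2 j = ∑ p, c p * (if p.2 = j then 1 else 0) := by
    intro r
    simp [marg, rootVert, Prod.snd_sum, Finset.sum_apply, Pi.single_apply, eq_comm]
  simp only [h1, h2, Finset.mul_sum]
  rw [Finset.sum_comm, Finset.sum_comm (s := (Finset.univ : Finset (Fin d))),
    ← Finset.sum_add_distrib]
  refine Finset.sum_congr rfl fun p _ => ?_
  simp
  ring

theorem functional_eq {n d : ℕ} {a b : Fin n × Fin d → ℝ} (h : marg a = marg b)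
    (u : Fin n → ℝ) (w : Fin d → ℝ) :
    ∑ p, a p * (u p.1 + w p.2) = ∑ p, b p * (u p.1 + w p.2) := by
  rw [marg_functional, marg_functional, h]

theorem total_eq {n d : ℕ} {a b : Fin n × Fin d → ℝ} (h : marg a = marg b) :
    ∑ p, a p = ∑ p, b p := by
  simpa using functional_eq h (fun _ => 1) (fun _ => 0)

theorem mem_rootPoly {n d : ℕ} (S : Set (Fin n × Fin d)) (x : (Fin n → ℝ) × (Fin d → ℝ)) :
    x ∈ rootPoly S ↔ ∃ c : Fin n × Fin d → ℝ, (∀ p, 0 ≤ c p) ∧ (∀ p, c p ≠ 0 → p ∈ S) ∧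
      ∑ p, c p = 1 ∧ marg c = x := by
  classical
  constructor
  · intro hx
    have hconv : Convex ℝ {x : (Fin n → ℝ) × (Fin d → ℝ) | ∃ c : Fin n × Fin d → ℝ,
        (∀ p, 0 ≤ c p) ∧ (∀ p, c p ≠ 0 → p ∈ S) ∧ ∑ p, c p = 1 ∧ marg c = x} := by
      rintro _ ⟨a, ha0, haS, ha1, rfl⟩ _ ⟨b, hb0, hbS, hb1, rfl⟩ s t hs ht hst
      refine ⟨s • a + t • b, ?_, ?_, ?_, ?_⟩
      · intro p
        have := mul_nonneg hs (ha0 p)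
        have := mul_nonneg ht (hb0 p)
        simp
        linarith
      · intro p hp
        by_contra hpS
        have h1 : a p = 0 := by
          by_contra h; exact hpS (haS p h)
        have h2 : b p = 0 := by
          by_contra h; exact hpS (hbS p h)
        simp [h1, h2] at hp
      · simp [Finset.sum_add_distrib, ← Finset.mul_sum, ha1, hb1, hst]
      · rw [marg_add, marg_smul, marg_smul]
    refine convexHull_min ?_ hconv hx
    rintro _ ⟨p, hp, rfl⟩
    refine ⟨Pi.single p 1, ?_, ?_, ?_, marg_single p⟩
    · intro q
      by_cases h : q = p
      · subst h; simp
      · simp [h]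
    · intro q hq
      by_cases h : q = p
      · subst h; exact hp
      · simp [h] at hq
    · simp
  · rintro ⟨c, hc0, hcS, hc1, rfl⟩
    have : marg c = ∑ p ∈ Finset.univ.filter (fun p => c p ≠ 0), c p • rootVert p := by
      unfold marg
      rw [Finset.sum_filter]
      refine Finset.sum_congr rfl fun p _ => ?_
      by_cases h : c p = 0 <;> simp [h]
    rw [this]
    refine (convex_convexHull ℝ _).sum_mem (fun p _ => hc0 p) ?_ ?_
    · rw [Finset.sum_filter_ne_zero]; exact hc1
    · intro p hp
      simp only [Finset.mem_filter, Finset.mem_univ, true_and] at hp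
      exact subset_convexHull ℝ _ ⟨p, hcS p hp, rfl⟩

theorem rootVert_mem_rootPoly {n d : ℕ} {S : Set (Fin n × Fin d)} {p : Fin n × Fin d}
    (h : rootVert p ∈ rootPoly S) : p ∈ S := by
  classical
  obtain ⟨c, hc0, hcS, hc1, hm⟩ := (mem_rootPoly S _).mp h
  rw [← marg_single p] at hm
  have h1 := functional_eq hm (fun r => if r = p.1 then 1 else 0) (fun j => if j = p.2 then 1 else 0)
  have h2 : ∑ q, (Pi.single p (1 : ℝ) : Fin n × Fin d → ℝ) q *
      ((if q.1 = p.1 then 1 else 0) + (if q.2 = p.2 then 1 else 0)) = 2 := by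
    rw [Finset.sum_eq_single p]
    · simp; norm_num
    · intro b _ hb
      simp [hb]
    · simp
  rw [h2] at h1
  by_contra hp
  have h3 : ∑ q, c q * ((if q.1 = p.1 then 1 else 0) + (if q.2 = p.2 then 1 else 0))
      ≤ ∑ q, c q := by
    refine Finset.sum_le_sum fun q _ => ?_
    by_cases hq : c q = 0
    · simp [hq]
    · have hne : q ≠ p := fun h => hp (h ▸ hcS q hq)
      have : ((if q.1 = p.1 then 1 else 0) + (if q.2 = p.2 then 1 else 0) : ℝ) ≤ 1 := by
        by_cases e1 : q.1 = p.1 <;> by_cases e2 : q.2 = p.2 <;> simp [e1, e2]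
        exact (hne (Prod.ext e1 e2)).elim
      nlinarith [hc0 q]
  linarith

/-- Support transfer for flows in cells of a subdivision, normalized version. -/
theorem cell_uniq_aux {n d : ℕ} {S T : Set (Fin n × Fin d)}
    (hext : IsExtreme ℝ (rootPoly S) (rootPoly S ∩ rootPoly T))
    {a b : Fin n × Fin d → ℝ} (ha0 : ∀ p, 0 ≤ a p) (hb0 : ∀ p, 0 ≤ b p)
    (haS : ∀ p, a p ≠ 0 → p ∈ S) (hbT : ∀ p, b p ≠ 0 → p ∈ T) (hm : marg a = marg b)
    (h1 : ∑ p, a p = 1) (p : Fin n × Fin d) (hp : a p ≠ 0) : p ∈ T := by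
  classical
  have hxS : marg a ∈ rootPoly S := (mem_rootPoly S _).mpr ⟨a, ha0, haS, h1, rfl⟩
  have hxT : marg a ∈ rootPoly T :=
    (mem_rootPoly T _).mpr ⟨b, hb0, hbT, by rw [← total_eq hm, h1], hm.symm⟩
  have hpS : rootVert p ∈ rootPoly S := subset_convexHull ℝ _ ⟨p, haS p hp, rfl⟩
  have hpos : 0 < a p := lt_of_le_of_ne (ha0 p) (Ne.symm hp)
  have hle : a p ≤ 1 := h1 ▸ Finset.single_le_sum (fun q _ => ha0 q) (Finset.mem_univ p)
  rcases hle.lt_or_eq with hlt | heq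
  · set t : ℝ := a p with ht
    set e : Fin n × Fin d → ℝ := Pi.single p 1 with he
    have ht1 : 0 < 1 - t := by linarith
    set a' : Fin n × Fin d → ℝ := (1 - t)⁻¹ • (a - t • e) with ha'
    have hsum : t • e + (1 - t) • a' = a := by
      rw [ha', smul_smul, mul_inv_cancel₀ ht1.ne', one_smul]
      abel
    have hy : marg a' ∈ rootPoly S := by
      refine (mem_rootPoly S _).mpr ⟨a', ?_, ?_, ?_, rfl⟩
      · intro q
        have : 0 ≤ (a - t • e) q := by
          by_cases h : q = p
          · subst h; simp [he, ht]
          · simp [he, h, ha0 q]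
        exact mul_nonneg (inv_nonneg.mpr ht1.le) this
      · intro q hq
        by_cases h : q = p
        · subst h; exact haS _ hp
        · apply haS
          intro h0
          apply hq
          simp [ha', he, h, h0]
      · have : ∑ q, (t • e + (1 - t) • a') q = 1 := by rw [hsum, h1]
        simp [he, Finset.sum_add_distrib, ← Finset.mul_sum] at this
        have h5 : (1 - t) * (∑ q, a' q) = (1 - t) * 1 := by linarith
        exact mul_left_cancel₀ ht1.ne' h5
    have hseg : marg a ∈ openSegment ℝ (rootVert p) (marg a') := by
      refine ⟨t, 1 - t, hpos, ht1, by ring, ?_⟩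
      rw [← marg_single, ← he, ← marg_smul, ← marg_smul, ← marg_add, hsum]
    exact rootVert_mem_rootPoly (hext.2 hpS hy ⟨hxS, hxT⟩ hseg).2
  · have : a = Pi.single p 1 := by
      funext q
      by_cases h : q = p
      · subst h; simp [heq]
      · have h6 : a p + a q ≤ ∑ q, a q := by
          rw [← Finset.sum_pair (Ne.symm h)]
          exact Finset.sum_le_sum_of_subset_of_nonneg (Finset.subset_univ _) (fun q _ _ => ha0 q)
        have := ha0 q
        simp [h]
        linarith
    rw [this, marg_single] at hxT
    exact rootVert_mem_rootPoly hxT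

theorem cell_uniq {n d : ℕ} {S T : Set (Fin n × Fin d)}
    (hext : IsExtreme ℝ (rootPoly S) (rootPoly S ∩ rootPoly T))
    {a b : Fin n × Fin d → ℝ} (ha0 : ∀ p, 0 ≤ a p) (hb0 : ∀ p, 0 ≤ b p)
    (haS : ∀ p, a p ≠ 0 → p ∈ S) (hbT : ∀ p, b p ≠ 0 → p ∈ T) (hm : marg a = marg b)
    (p : Fin n × Fin d) (hp : a p ≠ 0) : p ∈ T := by
  have hpos : 0 < a p := lt_of_le_of_ne (ha0 p) (Ne.symm hp)
  have hle : a p ≤ ∑ q, a q := Finset.single_le_sum (fun q _ => ha0 q) (Finset.mem_univ p)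
  set t := ∑ q, a q with ht
  have htp : 0 < t := lt_of_lt_of_le hpos hle
  refine cell_uniq_aux hext (a := t⁻¹ • a) (b := t⁻¹ • b) ?_ ?_ ?_ ?_ ?_ ?_ p ?_
  · exact fun q => mul_nonneg (inv_nonneg.mpr htp.le) (ha0 q)
  · exact fun q => mul_nonneg (inv_nonneg.mpr htp.le) (hb0 q)
  · intro q hq
    exact haS q (fun h => hq (by simp [h]))
  · intro q hq
    exact hbT q (fun h => hq (by simp [h]))
  · rw [marg_smul, marg_smul, hm]
  · simp [← Finset.mul_sum, ← ht, htp.ne']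
  · simp [htp.ne', hp]

/-- Two flows with equal marginals supported in `X` and in `Y` have their supports in both. -/
def Uniq {n d : ℕ} (X Y : Fin n → Finset (Fin d)) : Prop :=
  ∀ a b : Fin n × Fin d → ℝ, (∀ p, 0 ≤ a p) → (∀ p, 0 ≤ b p) →
    (∀ p, a p ≠ 0 → p.2 ∈ X p.1) → (∀ p, b p ≠ 0 → p.2 ∈ Y p.1) → marg a = marg b →
    (∀ p, a p ≠ 0 → p.2 ∈ Y p.1) ∧ (∀ p, b p ≠ 0 → p.2 ∈ X p.1)

theorem add_single_aux {n d : ℕ} {X : Fin n → Finset (Fin d)} {a : Fin n × Fin d → ℝ}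
    (ha0 : ∀ p, 0 ≤ a p) (haX : ∀ p, a p ≠ 0 → p.2 ∈ X p.1) {r : Fin n} {j : Fin d}
    (hj : j ∈ X r) :
    (∀ p, 0 ≤ (a + (Pi.single (r, j) 1 : Fin n × Fin d → ℝ)) p) ∧
      (∀ p, (a + (Pi.single (r, j) 1 : Fin n × Fin d → ℝ)) p ≠ 0 → p.2 ∈ X p.1) ∧
      (a + (Pi.single (r, j) 1 : Fin n × Fin d → ℝ)) (r, j) ≠ 0 := by
  classical
  refine ⟨?_, ?_, ?_⟩
  · intro p
    by_cases h : p = (r, j)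
    · subst h
      have := ha0 (r, j)
      simp
      linarith
    · simp [h, ha0 p]
  · intro p hp
    by_cases h : p = (r, j)
    · subst h; exact hj
    · exact haX p (by simpa [h] using hp)
  · have := ha0 (r, j)
    simp
    linarith

theorem potential {n d : ℕ} {X Y : Fin n → Finset (Fin d)} (h : Uniq X Y) :
    ∃ g : Fin d → ℕ, (∀ j, g j ≤ d) ∧ ∀ r j k, j ∈ X r → k ∈ Y r →
      g k ≤ g j ∧ (g k = g j → k ∈ X r ∧ j ∈ Y r) := by
  classical
  set R : Fin d → Fin d → Prop := fun j k => ∃ r, j ∈ X r ∧ k ∈ Y r with hR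
  have path : ∀ j k, Relation.ReflTransGen R j k → ∃ a b : Fin n × Fin d → ℝ,
      (∀ p, 0 ≤ a p) ∧ (∀ p, 0 ≤ b p) ∧ (∀ p, a p ≠ 0 → p.2 ∈ X p.1) ∧
      (∀ p, b p ≠ 0 → p.2 ∈ Y p.1) ∧
      marg a + (0, Pi.single k 1) = marg b + (0, Pi.single j 1) := by
    intro j k hjk
    induction hjk with
    | refl => exact ⟨0, 0, by simp, by simp, by simp, by simp, rfl⟩
    | @tail k l _ hkl ih =>
      obtain ⟨a, b, ha0, hb0, haX, hbY, hm⟩ := ih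
      obtain ⟨r, hk, hl⟩ := hkl
      obtain ⟨h1, h2, -⟩ := add_single_aux ha0 haX hk
      obtain ⟨h3, h4, -⟩ := add_single_aux hb0 hbY hl
      refine ⟨_, _, h1, h3, h2, h4, ?_⟩
      rw [marg_add, marg_add, marg_single, marg_single]
      have e1 : (rootVert (r, k) : (Fin n → ℝ) × (Fin d → ℝ)) =
          (Pi.single r 1, 0) + (0, Pi.single k 1) := by simp [rootVert]
      have e2 : (rootVert (r, l) : (Fin n → ℝ) × (Fin d → ℝ)) =
          (Pi.single r 1, 0) + (0, Pi.single l 1) := by simp [rootVert]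
      rw [e1, e2]
      calc marg a + ((Pi.single r 1, 0) + (0, Pi.single k 1)) + (0, Pi.single l 1)
          = (marg a + (0, Pi.single k 1)) + ((Pi.single r 1, 0) + (0, Pi.single l 1)) := by abel
        _ = _ := by rw [hm]; abel
  refine ⟨fun j => (Finset.univ.filter fun k => Relation.ReflTransGen R j k).card, ?_, ?_⟩
  · intro j
    exact (Finset.card_le_univ _).trans (by simp)
  · intro r j k hj hk
    have hjk : R j k := ⟨r, hj, hk⟩
    have hsub : (Finset.univ.filter fun l => Relation.ReflTransGen R k l) ⊆
        (Finset.univ.filter fun l => Relation.ReflTransGen R j l) := by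
      intro l hl
      simp only [Finset.mem_filter, Finset.mem_univ, true_and] at hl ⊢
      exact Relation.ReflTransGen.head hjk hl
    refine ⟨Finset.card_le_card hsub, fun heq => ?_⟩
    have hEq := Finset.eq_of_subset_of_card_le hsub heq.ge
    have hkj : Relation.ReflTransGen R k j := by
      have : j ∈ (Finset.univ.filter fun l => Relation.ReflTransGen R j l) := by
        simp only [Finset.mem_filter, Finset.mem_univ, true_and]
        exact Relation.ReflTransGen.refl
      rw [← hEq] at this
      simpa using this
    obtain ⟨a, b, ha0, hb0, haX, hbY, hm⟩ := path k j hkj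
    obtain ⟨h1, h2, h5⟩ := add_single_aux ha0 haX hj
    obtain ⟨h3, h4, h6⟩ := add_single_aux hb0 hbY hk
    have := h _ _ h1 h3 h2 h4 (by
      rw [marg_add, marg_add, marg_single, marg_single]
      have e1 : (rootVert (r, k) : (Fin n → ℝ) × (Fin d → ℝ)) =
          (Pi.single r 1, 0) + (0, Pi.single k 1) := by simp [rootVert]
      have e2 : (rootVert (r, j) : (Fin n → ℝ) × (Fin d → ℝ)) =
          (Pi.single r 1, 0) + (0, Pi.single j 1) := by simp [rootVert]
      rw [e1, e2]
      calc marg a + ((Pi.single r 1, 0) + (0, Pi.single j 1))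
          = (marg a + (0, Pi.single j 1)) + (Pi.single r 1, 0) := by abel
        _ = _ := by rw [hm]; abel)
    exact ⟨this.2 _ h6, this.1 _ h5⟩

/-- The family of all weight refinements of the members of `𝒢`. -/
def InM {n d : ℕ} (𝒢 : Finset (Finset (Fin n × Fin d))) (B : Fin n → Finset (Fin d)) : Prop :=
  ∃ G' ∈ 𝒢, ∃ w : Fin d → ℕ, IsMinW (graphType G') w B

theorem mem_graphType {n d : ℕ} {S : Finset (Fin n × Fin d)} {r : Fin n} {j : Fin d} :
    j ∈ graphType S r ↔ (r, j) ∈ S := by simp [graphType]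

theorem exists_flow {n d : ℕ} {G : Finset (Fin n × Fin d)} {𝒢 : Finset (Finset (Fin n × Fin d))}
    (henc : EncodesSubdivision (↑G : Set (Fin n × Fin d))
      {S | ∃ G' ∈ 𝒢, S = (↑G' : Set (Fin n × Fin d))})
    (q : Fin n × Fin d → ℝ) (hq0 : ∀ p, 0 ≤ q p) (hqG : ∀ p, q p ≠ 0 → p ∈ G)
    (hpos : 0 < ∑ p, q p) :
    ∃ G' ∈ 𝒢, ∃ c : Fin n × Fin d → ℝ, (∀ p, 0 ≤ c p) ∧ (∀ p, c p ≠ 0 → p.2 ∈ graphType G' p.1) ∧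
      marg c = marg q := by
  set t := ∑ p, q p with ht
  have hx : marg (t⁻¹ • q) ∈ rootPoly (↑G : Set (Fin n × Fin d)) := by
    refine (mem_rootPoly _ _).mpr ⟨t⁻¹ • q, ?_, ?_, ?_, rfl⟩
    · exact fun p => mul_nonneg (inv_nonneg.mpr hpos.le) (hq0 p)
    · intro p hp
      exact hqG p (fun h => hp (by simp [h]))
    · simp [← Finset.mul_sum, ← ht, hpos.ne']
  rw [← henc.1] at hx
  simp only [Set.mem_iUnion] at hx
  obtain ⟨S, ⟨G', hG', rfl⟩, hx⟩ := hx
  obtain ⟨c, hc0, hcS, -, hm⟩ := (mem_rootPoly _ _).mp hx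
  refine ⟨G', hG', t • c, fun p => mul_nonneg hpos.le (hc0 p), ?_, ?_⟩
  · intro p hp
    rw [mem_graphType]
    exact hcS p (fun h => hp (by simp [h]))
  · rw [marg_smul, hm, marg_smul, smul_smul, mul_inv_cancel₀ hpos.ne', one_smul]

theorem refine_support {n d : ℕ} {X A : Fin n → Finset (Fin d)} {w : Fin d → ℕ}
    (hA : IsMinW X w A) (hne : ∀ r, (X r).Nonempty) {a b : Fin n × Fin d → ℝ}
    (hb0 : ∀ p, 0 ≤ b p)
    (haA : ∀ p, a p ≠ 0 → p.2 ∈ A p.1) (hbX : ∀ p, b p ≠ 0 → p.2 ∈ X p.1)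
    (hm : marg a = marg b) (p : Fin n × Fin d) (hp : b p ≠ 0) : p.2 ∈ A p.1 := by
  choose κ hκ hκmin using fun r => Finset.exists_min_image (X r) w (hne r)
  have h1 := functional_eq hm (fun r => -(w (κ r) : ℝ)) (fun j => (w j : ℝ))
  have h2 : ∑ p, a p * (-(w (κ p.1) : ℝ) + (w p.2 : ℝ)) = 0 := by
    refine Finset.sum_eq_zero fun p _ => ?_
    by_cases h : a p = 0
    · simp [h]
    · have h3 := (hA _ _).mp (haA p h)
      have h4 : w p.2 = w (κ p.1) := le_antisymm (h3.2 _ (hκ _)) (hκmin _ _ h3.1)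
      simp [h4]
  rw [h2] at h1
  have h5 : ∀ p ∈ Finset.univ, 0 ≤ b p * (-(w (κ p.1) : ℝ) + (w p.2 : ℝ)) := by
    intro p _
    by_cases h : b p = 0
    · simp [h]
    · have : (w (κ p.1) : ℝ) ≤ w p.2 := by exact_mod_cast hκmin _ _ (hbX p h)
      exact mul_nonneg (hb0 p) (by linarith)
  have h6 := (Finset.sum_eq_zero_iff_of_nonneg h5).mp h1.symm p (Finset.mem_univ p)
  have h7 : (w p.2 : ℝ) = w (κ p.1) := by
    rcases mul_eq_zero.mp h6 with h | h
    · exact absurd h hp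
    · linarith
  have h8 : w p.2 = w (κ p.1) := by exact_mod_cast h7
  exact (hA _ _).mpr ⟨hbX p hp, fun k hk => h8 ▸ hκmin _ _ hk⟩

section Main

variable {n d : ℕ} {G : Finset (Fin n × Fin d)} {𝒢 : Finset (Finset (Fin n × Fin d))}

theorem uniq_of_inM (hne : ∀ G' ∈ 𝒢, ∀ r, (graphType G' r).Nonempty)
    (henc : EncodesSubdivision (↑G : Set (Fin n × Fin d))
      {S | ∃ G' ∈ 𝒢, S = (↑G' : Set (Fin n × Fin d))})
    {A B : Fin n → Finset (Fin d)} (hA : InM 𝒢 A) (hB : InM 𝒢 B) : Uniq A B := by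
  obtain ⟨S, hS, w, hw⟩ := hA
  obtain ⟨T, hT, v, hv⟩ := hB
  intro a b ha0 hb0 haA hbB hm
  have haS : ∀ p, a p ≠ 0 → p ∈ (↑S : Set (Fin n × Fin d)) := fun p hp => by
    have := ((hw _ _).mp (haA p hp)).1
    rwa [mem_graphType] at this
  have hbT : ∀ p, b p ≠ 0 → p ∈ (↑T : Set (Fin n × Fin d)) := fun p hp => by
    have := ((hv _ _).mp (hbB p hp)).1
    rwa [mem_graphType] at this
  have haT := cell_uniq (henc.2 _ ⟨S, hS, rfl⟩ _ ⟨T, hT, rfl⟩).1 ha0 hb0 haS hbT hm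
  have hbS := cell_uniq (henc.2 _ ⟨T, hT, rfl⟩ _ ⟨S, hS, rfl⟩).1 hb0 ha0 hbT haS hm.symm
  constructor
  · exact refine_support hv (hne T hT) ha0 hbB
      (fun p hp => mem_graphType.mpr (haT p hp)) hm.symm
  · exact refine_support hw (hne S hS) hb0 haA
      (fun p hp => mem_graphType.mpr (hbS p hp)) hm

/-- One step of the elimination procedure. -/
theorem elim_step (hn : 0 < n) (hne : ∀ G' ∈ 𝒢, ∀ r, (graphType G' r).Nonempty)
    (hsub : ∀ G' ∈ 𝒢, G' ⊆ G)
    (henc : EncodesSubdivision (↑G : Set (Fin n × Fin d))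
      {S | ∃ G' ∈ 𝒢, S = (↑G' : Set (Fin n × Fin d))})
    {A B : Fin n → Finset (Fin d)} (hA : InM 𝒢 A) (hB : InM 𝒢 B)
    (hAne : ∀ r, (A r).Nonempty) (hAB : A ≠ B) :
    ∃ G' ∈ 𝒢, ∃ RK : Set (Fin n), ∃ r₀ ∈ RK, A r₀ ≠ B r₀ ∧ ∃ yy : Fin n → ℤ,
      (∀ r, 0 ≤ yy r) ∧ ∀ θ : ℤ, -1 ≤ θ →
      ∃ ω : Fin d → ℤ, ∃ D : Fin n → Finset (Fin d), IsMinW (graphType G') ω D ∧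
        (∀ r, r ∉ RK → D r = A r) ∧ (∀ r ∈ RK, yy r < θ → D r = A r) ∧
        (∀ r ∈ RK, yy r = θ → D r = A r ∪ B r) ∧ (∀ r ∈ RK, θ < yy r → D r = B r) := by
  classical
  have hGsub : ∀ {E : Fin n → Finset (Fin d)}, InM 𝒢 E → ∀ r j, j ∈ E r → (r, j) ∈ G := by
    rintro E ⟨S, hS, w, hw⟩ r j hj
    exact hsub S hS (mem_graphType.mp ((hw _ _).mp hj).1)
  set N : ℝ := n * d * d + 1 with hN
  have hNpos : 0 < N := by positivity
  set q : Fin n × Fin d → ℝ := fun p =>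
    N * (if p.2 ∈ A p.1 then 1 else 0) + (if p.2 ∈ B p.1 then 1 else 0) with hq
  have hq0 : ∀ p, 0 ≤ q p := by
    intro p
    simp only [hq]
    split_ifs <;> simp <;> linarith
  have hqAB : ∀ p, q p ≠ 0 → p.2 ∈ A p.1 ∨ p.2 ∈ B p.1 := by
    intro p hp
    by_contra hcon
    push Not at hcon
    exact hp (by simp [hq, hcon.1, hcon.2])
  have hqpos : 0 < ∑ p, q p := by
    obtain ⟨j, hj⟩ := hAne ⟨0, hn⟩
    refine Finset.sum_pos' (fun p _ => hq0 p) ⟨(⟨0, hn⟩, j), Finset.mem_univ _, ?_⟩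
    simp only [hq, hj]
    split_ifs <;> simp <;> linarith
  obtain ⟨S, hS, c, hc0, hcS, hm⟩ := exists_flow henc q hq0 (fun p hp => by
    rcases hqAB p hp with h | h
    · exact hGsub hA _ _ h
    · exact hGsub hB _ _ h) hqpos
  set C := graphType S with hC
  have hCM : InM 𝒢 C := ⟨S, hS, fun _ => 0, by intro r j; simp [hC]⟩
  obtain ⟨y, hyd, hy⟩ := potential (uniq_of_inM hne henc hCM hA)
  obtain ⟨g, hgd, hg⟩ := potential (uniq_of_inM hne henc hCM hB)
  -- `A ⊆ C`
  have hAC : ∀ r j, j ∈ A r → j ∈ C r := by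
    choose κ hκ hκmin using fun r => Finset.exists_min_image (C r) y (hne S hS r)
    intro r j hj
    by_contra hjC
    have h1 := functional_eq hm (fun r => -(y (κ r) : ℝ)) (fun j => (y j : ℝ))
    have h2 : 0 ≤ ∑ p, c p * (-(y (κ p.1) : ℝ) + (y p.2 : ℝ)) := by
      refine Finset.sum_nonneg fun p _ => ?_
      by_cases h : c p = 0
      · simp [h]
      · have : (y (κ p.1) : ℝ) ≤ y p.2 := by exact_mod_cast hκmin _ _ (hcS p h)
        exact mul_nonneg (hc0 p) (by linarith)
    have h3 : ∑ p, q p * (-(y (κ p.1) : ℝ) + (y p.2 : ℝ)) ≤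
        ∑ p : Fin n × Fin d, ((if p = (r, j) then -N else 0) + (d : ℝ)) := by
      refine Finset.sum_le_sum fun p _ => ?_
      simp only [hq, add_mul]
      refine add_le_add ?_ ?_
      · by_cases hp : p.2 ∈ A p.1
        · obtain ⟨h4, h5⟩ := hy p.1 (κ p.1) p.2 (hκ _) hp
          by_cases hpe : p = (r, j)
          · subst hpe
            have h6 : y j < y (κ r) := lt_of_le_of_ne h4 (fun h => hjC (h5 h).1)
            have h7 : (y j : ℝ) + 1 ≤ y (κ r) := by exact_mod_cast h6
            simp only [hj, if_true]
            nlinarith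
          · have h7 : (y p.2 : ℝ) ≤ y (κ p.1) := by exact_mod_cast h4
            simp only [hp, hpe, if_true, if_false]
            nlinarith
        · have hpe : p ≠ (r, j) := by
            rintro rfl
            exact hp hj
          simp [hp, hpe]
      · have h8 : (y p.2 : ℝ) ≤ d := by exact_mod_cast hyd p.2
        have h9 : (0 : ℝ) ≤ y (κ p.1) := by positivity
        split_ifs
        · linarith
        · simp
    have h4 : ∑ p : Fin n × Fin d, ((if p = (r, j) then -N else 0) + (d : ℝ)) = -1 := by
      rw [Finset.sum_add_distrib, Finset.sum_ite_eq' Finset.univ]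
      simp [hN]
    linarith
  -- choice of the level
  obtain ⟨rb, hrb⟩ := Function.ne_iff.mp hAB
  obtain ⟨kb, hkb⟩ := hne S hS rb
  obtain ⟨⟨r₀, k₀⟩, hmem, hmin⟩ := Finset.exists_min_image
    (Finset.univ.filter fun p : Fin n × Fin d => p.2 ∈ C p.1 ∧ A p.1 ≠ B p.1) (fun p => g p.2)
    ⟨(rb, kb), by simp only [Finset.mem_filter, Finset.mem_univ, true_and]; exact ⟨hkb, hrb⟩⟩
  simp only [Finset.mem_filter, Finset.mem_univ, true_and] at hmem hmin
  set γ := g k₀ with hγ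
  have hlow : ∀ r k, k ∈ C r → g k < γ → A r = B r := by
    intro r k hk hlt
    by_contra hABr
    exact absurd (hmin (r, k) ⟨hk, hABr⟩) (not_le.mpr hlt)
  have hlowB : ∀ r k b, k ∈ C r → g k < γ → b ∈ B r → g b < γ :=
    fun r k b hk hlt hb => lt_of_le_of_lt (hg r k b hk hb).1 hlt
  -- rows not meeting the low columns in `C` do not meet them in `B`
  have hBL : ∀ r, (∀ k ∈ C r, γ ≤ g k) → ∀ b ∈ B r, γ ≤ g b := by
    intro r hr b hb
    by_contra hlt
    push Not at hlt
    have h1 := functional_eq hm (fun r => if ∃ k ∈ C r, g k < γ then (-1 : ℝ) else 0)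
      (fun j => if g j < γ then (1 : ℝ) else 0)
    have h2 : ∑ p, c p * ((if ∃ k ∈ C p.1, g k < γ then (-1 : ℝ) else 0) +
        (if g p.2 < γ then (1 : ℝ) else 0)) ≤ 0 := by
      refine Finset.sum_nonpos fun p _ => ?_
      by_cases h : c p = 0
      · simp [h]
      · refine mul_nonpos_of_nonneg_of_nonpos (hc0 p) ?_
        by_cases hp : g p.2 < γ
        · have : ∃ k ∈ C p.1, g k < γ := ⟨p.2, hcS p h, hp⟩
          simp [hp, this]
        · simp only [hp, if_false]
          split_ifs <;> simp
    have h3 : 0 < ∑ p, q p * ((if ∃ k ∈ C p.1, g k < γ then (-1 : ℝ) else 0) +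
        (if g p.2 < γ then (1 : ℝ) else 0)) := by
      refine Finset.sum_pos' (fun p _ => ?_) ⟨(r, b), Finset.mem_univ _, ?_⟩
      · by_cases h : q p = 0
        · simp [h]
        · refine mul_nonneg (hq0 p) ?_
          by_cases hex : ∃ k ∈ C p.1, g k < γ
          · obtain ⟨k, hk, hkγ⟩ := hex
            have hABp := hlow _ _ hk hkγ
            have hpB : p.2 ∈ B p.1 := by
              rcases hqAB p h with h' | h'
              · rwa [← hABp]
              · exact h'
            have hpl := hlowB _ _ _ hk hkγ hpB
            have hex : ∃ k ∈ C p.1, g k < γ := ⟨k, hk, hkγ⟩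
            simp [hex, hpl]
          · simp only [hex, if_false]
            split_ifs <;> simp
      · have hex : ¬ ∃ k ∈ C r, g k < γ := by
          rintro ⟨k, hk, hkγ⟩
          exact absurd (hr k hk) (not_le.mpr hkγ)
        have hqp : 0 < q (r, b) := by
          simp only [hq, hb]
          split_ifs <;> simp <;> linarith
        simp only [hex, hlt, if_false, if_true]
        simpa using hqp
    linarith
  choose α hα using hAne
  have hyα : ∀ r j, j ∈ A r → y j = y (α r) := fun r j hj =>
    le_antisymm (hy r (α r) j (hAC _ _ (hα r)) hj).1 (hy r j (α r) (hAC _ _ hj) (hα r)).1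
  have hyC : ∀ r j, j ∈ C r → y (α r) ≤ y j := fun r j hj => (hy r j (α r) hj (hα r)).1
  have hyCA : ∀ r j, j ∈ C r → y j ≤ y (α r) → j ∈ A r := fun r j hj hle =>
    ((hy r j (α r) hj (hα r)).2 (le_antisymm (hyC r j hj) hle)).2
  -- rows meeting the level set
  have hRK : ∀ r, (∀ k ∈ C r, γ ≤ g k) → (∃ k ∈ C r, g k = γ) →
      ∀ j, j ∈ B r ↔ j ∈ C r ∧ g j = γ := by
    rintro r hr ⟨k, hk, hkγ⟩ j
    constructor
    · intro hj
      have h1 := hg r k j hk hj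
      have h2 : g j = g k := le_antisymm h1.1 (hkγ ▸ hBL r hr j hj)
      exact ⟨(h1.2 h2).1, h2.trans hkγ⟩
    · rintro ⟨hj, hjγ⟩
      obtain ⟨b, hb⟩ : (B r).Nonempty := by
        obtain ⟨T, hT, v, hv⟩ := hB
        obtain ⟨b, hb, hbm⟩ := Finset.exists_min_image _ v (hne T hT r)
        exact ⟨b, (hv _ _).mpr ⟨hb, hbm⟩⟩
      have h1 := hg r j b hj hb
      exact (h1.2 (le_antisymm h1.1 (hjγ ▸ hBL r hr b hb))).2
  refine ⟨S, hS, {r | (∀ k ∈ C r, γ ≤ g k) ∧ ∃ k ∈ C r, g k = γ}, r₀, ?_, hmem.2,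
    fun r => (y (α r) : ℤ), fun r => by positivity, ?_⟩
  · refine ⟨fun k hk => hmin (r₀, k) ⟨hk, hmem.2⟩, k₀, hmem.1, rfl⟩
  intro θ hθ
  set ω : Fin d → ℤ := fun j => if g j < γ then (g j : ℤ) - d - 2 else
    if g j = γ then min (y j : ℤ) θ else y j with hω
  have hω1 : ∀ j, g j < γ → ω j = (g j : ℤ) - d - 2 := fun j h => by simp [hω, h]
  have hω3 : ∀ j, g j = γ → ω j = min (y j : ℤ) θ := fun j h => by simp [hω, h]
  have hω4 : ∀ j, γ < g j → ω j = y j := fun j h => by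
    simp [hω, not_lt.mpr h.le, h.ne']
  have hω2 : ∀ j, ¬ g j < γ → -1 ≤ ω j := by
    intro j h
    rcases (not_lt.mp h).eq_or_lt with h' | h'
    · rw [hω3 j h'.symm]
      exact le_min (by omega) hθ
    · rw [hω4 j h']
      omega
  have hRKω : ∀ r, (∀ k ∈ C r, γ ≤ g k) → (∃ k ∈ C r, g k = γ) → ∀ k ∈ C r,
      (k ∈ B r ∧ ω k = min (y k : ℤ) θ) ∨ (k ∉ B r ∧ ω k = y k) := by
    intro r h1 h2 k hk
    rcases (h1 k hk).eq_or_lt with h' | h'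
    · exact Or.inl ⟨(hRK r h1 h2 k).mpr ⟨hk, h'.symm⟩, hω3 k h'.symm⟩
    · exact Or.inr ⟨fun hb => h'.ne' ((hRK r h1 h2 k).mp hb).2, hω4 k h'⟩
  have hRKBC : ∀ r, (∀ k ∈ C r, γ ≤ g k) → (∃ k ∈ C r, g k = γ) → ∀ k ∈ B r, k ∈ C r :=
    fun r h1 h2 k hk => ((hRK r h1 h2 k).mp hk).1
  refine ⟨ω, fun r => (C r).filter fun j => ∀ k ∈ C r, ω j ≤ ω k, ?_, ?_, ?_, ?_, ?_⟩
  · intro r j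
    exact Finset.mem_filter
  · intro r hr
    by_cases hex : ∃ k ∈ C r, g k < γ
    · obtain ⟨k, hk, hkγ⟩ := hex
      have hABr := hlow r k hk hkγ
      ext j
      rw [Finset.mem_filter]
      constructor
      · rintro ⟨hj, hjmin⟩
        have hb : α r ∈ B r := hABr ▸ hα r
        have h1 := hlowB r k (α r) hk hkγ hb
        have h2 := hjmin (α r) (hAC _ _ (hα r))
        rw [hω1 _ h1] at h2
        have h3 := hg r j (α r) hj hb
        have h5 := hgd (α r)
        by_cases h4 : g j < γ
        · rw [hω1 _ h4] at h2
          rw [hABr]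
          exact (h3.2 (by omega)).2
        · have := hω2 j h4
          omega
      · intro hj
        refine ⟨hAC _ _ hj, fun l hl => ?_⟩
        have hb : j ∈ B r := hABr ▸ hj
        have h1 := hlowB r k j hk hkγ hb
        have h3 := hg r l j hl hb
        have h5 := hgd j
        rw [hω1 _ h1]
        by_cases h4 : g l < γ
        · rw [hω1 _ h4]
          omega
        · have := hω2 l h4
          omega
    · have hall : ∀ k ∈ C r, ω k = y k := by
        intro k hk
        refine hω4 k ?_
        by_contra h
        rcases (not_lt.mp h).eq_or_lt with h' | h'
        · refine hr ⟨fun l hl => ?_, k, hk, h'⟩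
          by_contra hl'
          exact hex ⟨l, hl, not_le.mp hl'⟩
        · exact hex ⟨k, hk, h'⟩
      ext j
      rw [Finset.mem_filter]
      constructor
      · rintro ⟨hj, hjmin⟩
        have h2 := hjmin (α r) (hAC _ _ (hα r))
        rw [hall _ hj, hall _ (hAC _ _ (hα r))] at h2
        exact hyCA r j hj (by exact_mod_cast h2)
      · intro hj
        refine ⟨hAC _ _ hj, fun l hl => ?_⟩
        rw [hall _ (hAC _ _ hj), hall _ hl, hyα r j hj]
        exact_mod_cast hyC r l hl
  · rintro r ⟨hr1, hr2⟩ hlt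
    simp only at hlt
    have hfact := hRKω r hr1 hr2
    ext j
    rw [Finset.mem_filter]
    constructor
    · rintro ⟨hj, hjmin⟩
      have h2 := hjmin (α r) (hAC _ _ (hα r))
      refine hyCA r j hj ?_
      rcases hfact j hj with h | h <;> rcases hfact _ (hAC _ _ (hα r)) with h' | h' <;>
        rw [h.2, h'.2] at h2 <;> omega
    · intro hj
      refine ⟨hAC _ _ hj, fun l hl => ?_⟩
      have h3 := hyα r j hj
      have h4 := hyC r l hl
      rcases hfact j (hAC _ _ hj) with h | h <;> rcases hfact _ hl with h' | h' <;>
        rw [h.2, h'.2] <;> omega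
  · rintro r ⟨hr1, hr2⟩ heq
    simp only at heq
    have hfact := hRKω r hr1 hr2
    ext j
    rw [Finset.mem_filter, Finset.mem_union]
    constructor
    · rintro ⟨hj, hjmin⟩
      have h2 := hjmin (α r) (hAC _ _ (hα r))
      rcases hfact j hj with h | h
      · exact Or.inr h.1
      · refine Or.inl (hyCA r j hj ?_)
        rcases hfact _ (hAC _ _ (hα r)) with h' | h' <;>
          rw [h.2, h'.2] at h2 <;> omega
    · rintro (hj | hj)
      · refine ⟨hAC _ _ hj, fun l hl => ?_⟩
        have h3 := hyα r j hj
        have h4 := hyC r l hl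
        rcases hfact j (hAC _ _ hj) with h | h <;> rcases hfact _ hl with h' | h' <;>
          rw [h.2, h'.2] <;> omega
      · refine ⟨hRKBC r hr1 hr2 j hj, fun l hl => ?_⟩
        have h4 := hyC r l hl
        have h5 := hyC r j (hRKBC r hr1 hr2 j hj)
        rcases hfact j (hRKBC r hr1 hr2 j hj) with h | h
        · rcases hfact _ hl with h' | h' <;> rw [h.2, h'.2] <;> omega
        · exact absurd hj h.1
  · rintro r ⟨hr1, hr2⟩ hlt
    simp only at hlt
    have hfact := hRKω r hr1 hr2
    ext j
    rw [Finset.mem_filter]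
    constructor
    · rintro ⟨hj, hjmin⟩
      obtain ⟨k, hk, hkγ⟩ := hr2
      have hkB := (hRK r hr1 ⟨k, hk, hkγ⟩ k).mpr ⟨hk, hkγ⟩
      have h2 := hjmin k hk
      have h4 := hyC r j hj
      rcases hfact j hj with h | h
      · exact h.1
      · rcases hfact k hk with h' | h'
        · rw [h.2, h'.2] at h2
          omega
        · exact absurd hkB h'.1
    · intro hj
      refine ⟨hRKBC r hr1 hr2 j hj, fun l hl => ?_⟩
      have h4 := hyC r l hl
      have h5 := hyC r j (hRKBC r hr1 hr2 j hj)
      rcases hfact j (hRKBC r hr1 hr2 j hj) with h | h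
      · rcases hfact _ hl with h' | h' <;> rw [h.2, h'.2] <;> omega
      · exact absurd hj h.1

end Main

section Final

variable {n d : ℕ} {G : Finset (Fin n × Fin d)} {𝒢 : Finset (Finset (Fin n × Fin d))}

theorem inM_of_weight {α : Type*} [LinearOrder α]
    (hne : ∀ G' ∈ 𝒢, ∀ r, (graphType G' r).Nonempty) {S : Finset (Fin n × Fin d)} (hS : S ∈ 𝒢)
    {w : Fin d → α} {B : Fin n → Finset (Fin d)} (h : IsMinW (graphType S) w B) : InM 𝒢 B := by
  obtain ⟨P, hP⟩ := isRefinement_of_weight w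
  obtain ⟨v, hv⟩ := weight_of_isRefinement P
  exact ⟨S, hS, v, hv _ _ _ (hP _ _ _ (hne S hS) h)⟩

theorem inM_iff (hne : ∀ G' ∈ 𝒢, ∀ r, (graphType G' r).Nonempty) {B : Fin n → Finset (Fin d)} :
    B ∈ {B | ∃ G' ∈ 𝒢, ∃ P : OrderedPartition d, IsRefinement (graphType G') P B} ↔ InM 𝒢 B := by
  constructor
  · rintro ⟨S, hS, P, hP⟩
    obtain ⟨v, hv⟩ := weight_of_isRefinement P
    exact ⟨S, hS, v, hv _ _ _ hP⟩
  · rintro ⟨S, hS, w, hw⟩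
    obtain ⟨P, hP⟩ := isRefinement_of_weight w
    exact ⟨S, hS, P, hP _ _ _ (hne S hS) hw⟩

theorem inM_nonempty (hne : ∀ G' ∈ 𝒢, ∀ r, (graphType G' r).Nonempty)
    {B : Fin n → Finset (Fin d)} (hB : InM 𝒢 B) (r : Fin n) : (B r).Nonempty := by
  obtain ⟨T, hT, v, hv⟩ := hB
  obtain ⟨b, hb, hbm⟩ := Finset.exists_min_image _ v (hne T hT r)
  exact ⟨b, (hv _ _).mpr ⟨hb, hbm⟩⟩

theorem elim_all (hn : 0 < n) (hne : ∀ G' ∈ 𝒢, ∀ r, (graphType G' r).Nonempty)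
    (hsub : ∀ G' ∈ 𝒢, G' ⊆ G)
    (henc : EncodesSubdivision (↑G : Set (Fin n × Fin d))
      {S | ∃ G' ∈ 𝒢, S = (↑G' : Set (Fin n × Fin d))})
    {B : Fin n → Finset (Fin d)} (hB : InM 𝒢 B) (i : Fin n) :
    ∀ (m : ℕ) (A : Fin n → Finset (Fin d)), InM 𝒢 A →
      (Finset.univ.filter fun r => A r ≠ B r).card ≤ m →
      ∃ C, InM 𝒢 C ∧ C i = A i ∪ B i ∧
        ∀ r, C r = A r ∨ C r = B r ∨ C r = A r ∪ B r := by
  intro m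
  induction m with
  | zero =>
    intro A hA hcard
    have hAB : A = B := by
      funext r
      by_contra h
      have := Finset.eq_empty_iff_forall_notMem.mp (Finset.card_eq_zero.mp (Nat.le_zero.mp hcard)) r
      exact this (by simp [h])
    exact ⟨A, hA, by simp [hAB], fun r => Or.inl rfl⟩
  | succ m ih =>
    intro A hA hcard
    by_cases hAB : A = B
    · exact ⟨A, hA, by simp [hAB], fun r => Or.inl rfl⟩
    obtain ⟨S, hS, RK, r₀, hr₀, hne₀, yy, hyy, hstep⟩ :=
      elim_step hn hne hsub henc hA hB (inM_nonempty hne hA) hAB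
    by_cases hi : i ∈ RK
    · obtain ⟨ω, D, hD, h1, h2, h3, h4⟩ := hstep (yy i) (by linarith [hyy i])
      refine ⟨D, inM_of_weight hne hS hD, h3 i hi rfl, fun r => ?_⟩
      by_cases hr : r ∈ RK
      · rcases lt_trichotomy (yy r) (yy i) with h | h | h
        · exact Or.inl (h2 r hr h)
        · exact Or.inr (Or.inr (h3 r hr h))
        · exact Or.inr (Or.inl (h4 r hr h))
      · exact Or.inl (h1 r hr)
    · obtain ⟨ω, D, hD, h1, h2, h3, h4⟩ := hstep (-1) le_rfl
      have hDB : ∀ r ∈ RK, D r = B r := fun r hr => h4 r hr (by linarith [hyy r])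
      have hlt : (Finset.univ.filter fun r => D r ≠ B r).card <
          (Finset.univ.filter fun r => A r ≠ B r).card := by
        refine Finset.card_lt_card ⟨?_, ?_⟩
        · intro r hr
          simp only [Finset.mem_filter, Finset.mem_univ, true_and] at hr ⊢
          by_cases hrR : r ∈ RK
          · exact absurd (hDB r hrR) hr
          · rwa [← h1 r hrR]
        · intro hcon
          have := hcon (x := r₀) (by simp [hne₀])
          simp only [Finset.mem_filter, Finset.mem_univ, true_and] at this
          exact this (hDB r₀ hr₀)
      obtain ⟨C, hC, hCi, hCr⟩ := ih D (inM_of_weight hne hS hD) (by omega)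
      refine ⟨C, hC, by rw [hCi, h1 i hi], fun r => ?_⟩
      by_cases hr : r ∈ RK
      · have := hCr r
        rw [hDB r hr, Finset.union_self] at this
        tauto
      · rw [← h1 r hr]
        exact hCr r

theorem boundary_mem (hn : 0 < n) (hne : ∀ G' ∈ 𝒢, ∀ r, (graphType G' r).Nonempty)
    (hsub : ∀ G' ∈ 𝒢, G' ⊆ G)
    (henc : EncodesSubdivision (↑G : Set (Fin n × Fin d))
      {S | ∃ G' ∈ 𝒢, S = (↑G' : Set (Fin n × Fin d))})
    (σ : Equiv.Perm (Fin d)) (B : Fin n → Finset (Fin d))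
    (h : IsTotalRefinement (graphType G) σ B) : InM 𝒢 B := by
  classical
  choose β hβ hB hmin using h
  set q : Fin n × Fin d → ℝ := fun p => if p.2 = β p.1 then 1 else 0 with hq
  have hq0 : ∀ p, 0 ≤ q p := by
    intro p
    simp only [hq]
    split_ifs <;> simp
  have hqne : ∀ p, q p ≠ 0 → p.2 = β p.1 := by
    intro p hp
    by_contra hcon
    exact hp (by simp [hq, hcon])
  obtain ⟨S, hS, c, hc0, hcS, hm⟩ := exists_flow henc q hq0 (fun p hp => by
    have h1 := mem_graphType.mp (hβ p.1)
    rw [← hqne p hp] at h1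
    exact h1) (Finset.sum_pos' (fun p _ => hq0 p)
      ⟨(⟨0, hn⟩, β ⟨0, hn⟩), Finset.mem_univ _, by simp [hq]⟩)
  have hSG : ∀ r j, j ∈ graphType S r → j ∈ graphType G r := fun r j hj =>
    mem_graphType.mpr (hsub S hS (mem_graphType.mp hj))
  have hcβ : ∀ p, c p ≠ 0 → p.2 = β p.1 := by
    intro p hp
    have h1 := functional_eq hm (fun r => -((σ (β r) : ℕ) : ℝ)) (fun j => ((σ j : ℕ) : ℝ))
    have h2 : ∑ p, q p * (-((σ (β p.1) : ℕ) : ℝ) + ((σ p.2 : ℕ) : ℝ)) = 0 := by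
      refine Finset.sum_eq_zero fun p _ => ?_
      by_cases h : q p = 0
      · simp [h]
      · simp [hqne p h]
    rw [h2] at h1
    have h5 : ∀ p ∈ Finset.univ, 0 ≤ c p * (-((σ (β p.1) : ℕ) : ℝ) + ((σ p.2 : ℕ) : ℝ)) := by
      intro p _
      by_cases h : c p = 0
      · simp [h]
      · have : ((σ (β p.1) : ℕ) : ℝ) ≤ (σ p.2 : ℕ) := by
          exact_mod_cast hmin _ _ (hSG _ _ (hcS p h))
        exact mul_nonneg (hc0 p) (by linarith)
    have h6 := (Finset.sum_eq_zero_iff_of_nonneg h5).mp h1 p (Finset.mem_univ p)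
    have h7 : ((σ p.2 : ℕ) : ℝ) = (σ (β p.1) : ℕ) := by
      rcases mul_eq_zero.mp h6 with h | h
      · exact absurd h hp
      · linarith
    have h8 : (σ p.2 : ℕ) = σ (β p.1) := by exact_mod_cast h7
    exact σ.injective (Fin.ext h8)
  have hβS : ∀ r, β r ∈ graphType S r := by
    intro r
    by_contra hcon
    have h1 := functional_eq hm (fun s => if s = r then (1 : ℝ) else 0) (fun _ => 0)
    have h2 : ∑ p, c p * ((if p.1 = r then (1 : ℝ) else 0) + 0) = 0 := by
      refine Finset.sum_eq_zero fun p _ => ?_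
      by_cases hp : p.1 = r
      · by_cases h : c p = 0
        · simp [h]
        · have h3 := hcS p h
          rw [hcβ p h, hp] at h3
          exact absurd h3 hcon
      · simp [hp]
    have h3 : 0 < ∑ p, q p * ((if p.1 = r then (1 : ℝ) else 0) + 0) := by
      refine Finset.sum_pos' (fun p _ => mul_nonneg (hq0 p) ?_) ⟨(r, β r), Finset.mem_univ _, ?_⟩
      · split_ifs <;> simp
      · simp [hq]
    linarith
  refine inM_of_weight hne hS (w := σ) ?_
  intro r j
  rw [hB r, Finset.mem_singleton]
  constructor
  · rintro rfl
    exact ⟨hβS r, fun k hk => hmin r k (hSG r k hk)⟩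
  · rintro ⟨hj, hjm⟩
    exact σ.injective (le_antisymm (hjm _ (hβS r)) (hmin r j (hSG r j hj)))

theorem surrounding_mem (hne : ∀ G' ∈ 𝒢, ∀ r, (graphType G' r).Nonempty)
    {A : Fin n → Finset (Fin d)} (hA : InM 𝒢 A) (P : OrderedPartition d)
    (B : Fin n → Finset (Fin d)) (h : IsRefinement A P B) : InM 𝒢 B := by
  obtain ⟨v, hv⟩ := weight_of_isRefinement P
  have hAne := inM_nonempty hne hA
  obtain ⟨S, hS, w, hw⟩ := hA
  have hB := hv _ _ _ h
  refine inM_of_weight hne hS (w := fun j => toLex (w j, v j)) ?_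
  intro r j
  rw [hB r j, hw r j]
  constructor
  · rintro ⟨⟨h1, h2⟩, h3⟩
    refine ⟨h1, fun k hk => ?_⟩
    rw [Prod.Lex.toLex_le_toLex]
    rcases (h2 k hk).lt_or_eq with h4 | h4
    · exact Or.inl h4
    · exact Or.inr ⟨h4, h3 k ((hw r k).mpr ⟨hk, fun l hl => h4 ▸ h2 l hl⟩)⟩
  · rintro ⟨h1, h2⟩
    have h3 : ∀ k ∈ graphType S r, w j < w k ∨ w j = w k ∧ v j ≤ v k := fun k hk => by
      have := h2 k hk
      rwa [Prod.Lex.toLex_le_toLex] at this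
    have h4 : ∀ k ∈ graphType S r, w j ≤ w k := fun k hk => by
      rcases h3 k hk with h | h
      · exact h.le
      · exact h.1.le
    refine ⟨⟨h1, h4⟩, fun k hk => ?_⟩
    have hk' := (hw r k).mp hk
    rcases h3 k hk'.1 with h | h
    · exact absurd (hk'.2 j h1) (not_le.mpr h)
    · exact h.2

theorem marg_sum {ι : Type*} (s : Finset ι) (f : ι → Fin n × Fin d) :
    marg (∑ t ∈ s, (Pi.single (f t) 1 : Fin n × Fin d → ℝ)) = ∑ t ∈ s, rootVert (f t) := by
  classical
  induction s using Finset.induction_on with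
  | empty =>
    have := marg_smul (0 : ℝ) (0 : Fin n × Fin d → ℝ)
    simpa using this
  | insert a s ha ih => rw [Finset.sum_insert ha, Finset.sum_insert ha, marg_add, marg_single, ih]

theorem sum_single_nonneg {k : ℕ} (f : Fin k → Fin n × Fin d) (p : Fin n × Fin d) :
    0 ≤ (∑ t, (Pi.single (f t) 1 : Fin n × Fin d → ℝ)) p := by
  classical
  rw [Finset.sum_apply]
  refine Finset.sum_nonneg fun t _ => ?_
  rw [Pi.single_apply]
  split_ifs <;> simp

theorem sum_single_pos {k : ℕ} (f : Fin k → Fin n × Fin d) (t : Fin k) :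
    (∑ t, (Pi.single (f t) 1 : Fin n × Fin d → ℝ)) (f t) ≠ 0 := by
  classical
  rw [Finset.sum_apply]
  refine ne_of_gt (Finset.sum_pos' (fun s _ => ?_) ⟨t, Finset.mem_univ _, by simp⟩)
  rw [Pi.single_apply]
  split_ifs <;> simp

theorem sum_single_ne {k : ℕ} (f : Fin k → Fin n × Fin d) (p : Fin n × Fin d)
    (h : (∑ t, (Pi.single (f t) 1 : Fin n × Fin d → ℝ)) p ≠ 0) : ∃ t, p = f t := by
  classical
  rw [Finset.sum_apply] at h
  obtain ⟨t, -, ht⟩ := Finset.exists_ne_zero_of_sum_ne_zero h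
  refine ⟨t, ?_⟩
  by_contra hcon
  exact ht (by simp [Pi.single_apply, hcon])

theorem compatible_of_uniq {A B : Fin n → Finset (Fin d)} (h : Uniq A B) :
    Compatible (typeEdges A) (typeEdges B) := by
  intro k i j _ _ hA hB t
  have hm : marg (∑ t, (Pi.single (i t, j t) 1 : Fin n × Fin d → ℝ)) =
      marg (∑ t, (Pi.single (i (t + 1), j t) 1 : Fin n × Fin d → ℝ)) := by
    rw [marg_sum, marg_sum]
    refine Prod.ext ?_ ?_
    · rw [Prod.fst_sum, Prod.fst_sum]
      exact (Equiv.sum_comp (Equiv.addRight (1 : Fin (k + 2)))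
        (fun t => (Pi.single (i t) 1 : Fin n → ℝ))).symm
    · rw [Prod.snd_sum, Prod.snd_sum]
      rfl
  have hu := h _ _ (sum_single_nonneg _) (sum_single_nonneg _)
    (fun p hp => by
      obtain ⟨t, rfl⟩ := sum_single_ne _ _ hp
      exact hA t)
    (fun p hp => by
      obtain ⟨t, rfl⟩ := sum_single_ne _ _ hp
      exact hB t) hm
  exact ⟨hA t, hu.1 _ (sum_single_pos (fun t => (i t, j t)) t),
    hu.2 _ (sum_single_pos (fun t => (i (t + 1), j t)) t), hB t⟩

end Final

/-- the refinements of the types of the cells of a polyhedral subdivision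
of the root polytope `Q_G` form a `G`-tropical oriented matroid. -/
theorem subdivision_gives_gtom {n d : ℕ} (hn : 0 < n) (hd : 0 < d)
    (G : Finset (Fin n × Fin d)) (hGconn : IsConn (↑G : Set (Fin n × Fin d)))
    (𝒢 : Finset (Finset (Fin n × Fin d)))
    (hsub : ∀ G' ∈ 𝒢, G' ⊆ G)
    (hconn : ∀ G' ∈ 𝒢, IsConn (↑G' : Set (Fin n × Fin d)))
    (henc : EncodesSubdivision (↑G : Set (Fin n × Fin d))
      {S | ∃ G' ∈ 𝒢, S = (↑G' : Set (Fin n × Fin d))}) :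
    IsGTOM G {B | ∃ G' ∈ 𝒢, ∃ P : OrderedPartition d, IsRefinement (graphType G') P B} := by
  have hne : ∀ G' ∈ 𝒢, ∀ r, (graphType G' r).Nonempty := fun G' hG' r =>
    row_nonempty_of_isConn hd G' (hconn G' hG') r
  refine ⟨?_, ?_, ?_, ?_, ?_, ?_⟩
  · intro A hA
    exact inM_nonempty hne ((inM_iff hne).mp hA)
  · intro A hA p hp
    obtain ⟨S, hS, w, hw⟩ := (inM_iff hne).mp hA
    exact hsub S hS (mem_graphType.mp ((hw _ _).mp hp).1)
  · intro σ B hB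
    exact (inM_iff hne).mpr (boundary_mem hn hne hsub henc σ B hB)
  · intro A hA P B hB
    exact (inM_iff hne).mpr (surrounding_mem hne ((inM_iff hne).mp hA) P B hB)
  · intro A hA B hB
    exact compatible_of_uniq
      (uniq_of_inM hne henc ((inM_iff hne).mp hA) ((inM_iff hne).mp hB))
  · intro A hA B hB i
    obtain ⟨C, hC, h1, h2⟩ := elim_all hn hne hsub henc ((inM_iff hne).mp hB) i _ A
      ((inM_iff hne).mp hA) le_rfl
    exact ⟨C, (inM_iff hne).mpr hC, h1, h2⟩
end
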